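/- Let Φ and Ψ be positive linear trace-non-increasing maps from 𝔗(H) to 𝔗(H') and let λ ∈ (0,1). The map λΦ + (1−λ)Ψ has continuous (equivalently, finite and bounded) output entropy on 𝔖(H) if and only if both Φ and Ψ have continuous output entropy on 𝔖(H). -/

import Mathlib

open scoped ENNReal NNReal
open Filter Topology Classical
attribute [local instance] Classical.propDecidable

noncomputable section

namespace QIT

section Defs

variable {E F G : Type*}
variable [NormedAddCommGroup E] [InnerProductSpace ℂ E] [CompleteSpace E]
variable [NormedAddCommGroup F] [InnerProductSpace ℂ F] [CompleteSpace F]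
variable [NormedAddCommGroup G] [InnerProductSpace ℂ G] [CompleteSpace G]

/-- The real part of `⟪x, A x⟫`. -/
def qf (A : E →L[ℂ] E) (x : E) : ℝ := (inner ℂ x (A x) : ℂ).re

/-- The trace of a positive operator, as the supremum of finite diagonal sums over
finite orthonormal families.  For positive operators this coincides with the usual
trace (with value `∞` when the operator is not trace class). -/
def traceENN (A : E →L[ℂ] E) : ℝ≥0∞ :=
  ⨆ (n : ℕ) (e : Fin n → E) (_ : Orthonormal ℂ e), ∑ i, ENNReal.ofReal (qf A (e i))

/-- The trace norm `‖A‖₁`, as the supremum of `∑ |⟪e i, A (f i)⟫|` over pairs of finite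
orthonormal families; it is finite exactly on trace-class operators. -/
def traceNorm (A : E →L[ℂ] E) : ℝ≥0∞ :=
  ⨆ (n : ℕ) (e : Fin n → E) (f : Fin n → E) (_ : Orthonormal ℂ e) (_ : Orthonormal ℂ f),
    ∑ i, ENNReal.ofReal ‖(inner ℂ (e i) (A (f i)) : ℂ)‖

/-- `A` is a trace-class operator. -/
def IsTC (A : E →L[ℂ] E) : Prop := traceNorm A ≠ ∞

/-- The cone `𝔗₊(E)` of positive trace-class operators. -/
def posTC (E : Type*) [NormedAddCommGroup E] [InnerProductSpace ℂ E] [CompleteSpace E] :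
    Set (E →L[ℂ] E) := {A | A.IsPositive ∧ IsTC A}

/-- The set `𝔖(E)` of states (density operators). -/
def states (E : Type*) [NormedAddCommGroup E] [InnerProductSpace ℂ E] [CompleteSpace E] :
    Set (E →L[ℂ] E) := {A | A.IsPositive ∧ traceENN A = 1}

/-- The extended classical entropy `H({x_i}) = ∑ η(x_i) − η(∑ x_i)` of a nonnegative
summable family, written in the equivalent homogeneous form `(∑ x) · H({x_i/∑x})`. -/
def clEntropy {ι : Type*} (x : ι → ℝ) : ℝ≥0∞ :=
  ENNReal.ofReal (∑' i, x i) *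
    ∑' i, ENNReal.ofReal (Real.negMulLog (x i / (∑' j, x j)))

/-- An orthonormal subset with dense span (an orthonormal basis, as a set). -/
def IsONB (s : Set E) : Prop :=
  Orthonormal ℂ ((↑) : s → E) ∧ Dense ((Submodule.span ℂ s : Submodule ℂ E) : Set E)

/-- The quantum (von Neumann) entropy `H(A) = Tr η(A) − η(Tr A)` of a positive trace-class
operator, realized as the infimum over all orthonormal bases of the classical entropy of
the diagonal of `A` (the infimum is attained on an eigenbasis of `A`). -/
def qEntropy (A : E →L[ℂ] E) : ℝ≥0∞ :=
  ⨅ (s : Set E) (_ : IsONB s), clEntropy fun v : s => qf A v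

theorem exists_isONB (E : Type*) [NormedAddCommGroup E] [InnerProductSpace ℂ E]
    [CompleteSpace E] : ∃ s : Set E, IsONB s := by
  obtain ⟨w, b, hb⟩ := exists_hilbertBasis ℂ E
  refine ⟨w, ?_, ?_⟩
  · have h := b.orthonormal
    rwa [hb] at h
  · have h := b.dense_span
    rw [hb, Subtype.range_coe] at h
    rwa [Submodule.dense_iff_topologicalClosure_eq_top]

/-- A fixed orthonormal basis (as a set). -/
def stdONB (E : Type*) [NormedAddCommGroup E] [InnerProductSpace ℂ E] [CompleteSpace E] :
    Set E := (exists_isONB E).choose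

/-- The `ℂ`-valued trace, computed in a fixed orthonormal basis; for trace-class
operators it does not depend on the choice of the basis. -/
def traceC (A : E →L[ℂ] E) : ℂ := ∑' v : stdONB E, (inner ℂ (v : E) (A v) : ℂ)

/-- Continuity (including finiteness) of an `ℝ≥0∞`-valued function on a subset of
operators, with respect to the trace-norm distance. -/
def ContOn (f : (E →L[ℂ] E) → ℝ≥0∞) (𝒜 : Set (E →L[ℂ] E)) : Prop :=
  (∀ A ∈ 𝒜, f A ≠ ∞) ∧
  ∀ A ∈ 𝒜, ∀ ε : ℝ, 0 < ε → ∃ δ : ℝ, 0 < δ ∧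
    ∀ B ∈ 𝒜, traceNorm (B - A) < ENNReal.ofReal δ → |(f B).toReal - (f A).toReal| < ε

/-- Continuity of a real-valued function on a subset of operators with respect to the
trace-norm distance. -/
def RContOn (g : (E →L[ℂ] E) → ℝ) (𝒜 : Set (E →L[ℂ] E)) : Prop :=
  ∀ A ∈ 𝒜, ∀ ε : ℝ, 0 < ε → ∃ δ : ℝ, 0 < δ ∧
    ∀ B ∈ 𝒜, traceNorm (B - A) < ENNReal.ofReal δ → |g B - g A| < ε

/-- Boundedness of an `ℝ≥0∞`-valued function on a set. -/
def BddOn (f : (E →L[ℂ] E) → ℝ≥0∞) (𝒜 : Set (E →L[ℂ] E)) : Prop :=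
  ∃ C : ℝ, ∀ A ∈ 𝒜, f A ≤ ENNReal.ofReal C

/-- Convergence of a sequence of operators in the trace norm. -/
def TendstoTN (A : ℕ → (E →L[ℂ] E)) (A₀ : E →L[ℂ] E) : Prop :=
  ∀ ε : ℝ, 0 < ε → ∃ N : ℕ, ∀ n ≥ N, traceNorm (A n - A₀) < ENNReal.ofReal ε

/-- A positive linear map from the trace class of `E` to the trace class of `F`
(the values of `toFun` outside the trace class are irrelevant). -/
structure TraceMap (E F : Type*) [NormedAddCommGroup E] [InnerProductSpace ℂ E]
    [CompleteSpace E] [NormedAddCommGroup F] [InnerProductSpace ℂ F] [CompleteSpace F] where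
  toFun : (E →L[ℂ] E) → (F →L[ℂ] F)
  map_add : ∀ A B, IsTC A → IsTC B → toFun (A + B) = toFun A + toFun B
  map_smul : ∀ (c : ℂ) A, IsTC A → toFun (c • A) = c • toFun A
  maps_tc : ∀ A, IsTC A → IsTC (toFun A)
  pos : ∀ A, IsTC A → A.IsPositive → (toFun A).IsPositive

/-- A trace-non-increasing map. -/
def TraceMap.TNI (Φ : TraceMap E F) : Prop :=
  ∀ A, IsTC A → A.IsPositive → traceENN (Φ.toFun A) ≤ traceENN A

/-- A trace-preserving map. -/
def TraceMap.TP (Φ : TraceMap E F) : Prop :=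
  ∀ A, IsTC A → A.IsPositive → traceENN (Φ.toFun A) = traceENN A

/-- A map bounded with respect to the trace norm. -/
def TraceMap.Bounded (Φ : TraceMap E F) : Prop :=
  ∃ C : ℝ≥0, ∀ A, traceNorm (Φ.toFun A) ≤ (C : ℝ≥0∞) * traceNorm A

/-- The output entropy `H_Φ = H ∘ Φ`. -/
def outEntropy (Φ : TraceMap E F) (A : E →L[ℂ] E) : ℝ≥0∞ := qEntropy (Φ.toFun A)

/-- The rank-one operator `|x⟩⟨x|`. -/
def rankOne (x : E) : E →L[ℂ] E := (innerSL ℂ x).smulRight x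

/-- The rank-one operator `|x⟩⟨y|`. -/
def rankOneM (x y : E) : E →L[ℂ] E := (innerSL ℂ y).smulRight x

end Defs

section Defs2

variable {E F G : Type*}
variable [NormedAddCommGroup E] [InnerProductSpace ℂ E] [CompleteSpace E]
variable [NormedAddCommGroup F] [InnerProductSpace ℂ F] [CompleteSpace F]
variable [NormedAddCommGroup G] [InnerProductSpace ℂ G] [CompleteSpace G]

/-- The completely positive map `A ↦ ∑ᵢ Vᵢ A Vᵢ*` defined by a sequence of Kraus
operators. -/
def krausMap (V : ℕ → (E →L[ℂ] F)) (A : E →L[ℂ] E) : F →L[ℂ] F :=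
  ∑' i, V i ∘L A ∘L ContinuousLinearMap.adjoint (V i)

/-- The Kraus condition `∑ᵢ Vᵢ* Vᵢ ≤ I` (all partial sums are dominated by `I`). -/
def KrausTNI (V : ℕ → (E →L[ℂ] F)) : Prop :=
  ∀ n : ℕ,
    ((1 : E →L[ℂ] E) - ∑ i ∈ Finset.range n, ContinuousLinearMap.adjoint (V i) ∘L V i).IsPositive

/-- The Kraus condition `∑ᵢ Vᵢ* Vᵢ = I` (strong convergence), i.e. trace preservation. -/
def KrausTP (V : ℕ → (E →L[ℂ] F)) : Prop :=
  ∀ x : E, HasSum (fun i => (ContinuousLinearMap.adjoint (V i)) (V i x)) x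

/-- `(Φ, Φt)` is a complementary pair of quantum operations: for some Kraus
representation `Φ(·) = ∑ᵢ Vᵢ (·) Vᵢ*` and some orthonormal basis `{bᵢ}` of `G`,
`Φt(A) = ∑_{i,j} Tr[Vᵢ A Vⱼ*] |bᵢ⟩⟨bⱼ|` (characterized by its matrix entries). -/
def IsComplementaryPair (Φ : TraceMap E F) (Φt : TraceMap E G) : Prop :=
  ∃ (V : ℕ → (E →L[ℂ] F)) (b : HilbertBasis ℕ ℂ G),
    KrausTNI V ∧
    (∀ A, IsTC A → Φ.toFun A = krausMap V A) ∧
    (∀ A, IsTC A → ∀ i j : ℕ,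
      (inner ℂ (b i) (Φt.toFun A (b j)) : ℂ) =
        traceC (V i ∘L A ∘L ContinuousLinearMap.adjoint (V j)))

/-- A map (on trace-class operators) preserves continuity of the entropy:
its output entropy is continuous on every subset of the positive trace-class cone on
which the von Neumann entropy is continuous. -/
def PCE (Φf : (E →L[ℂ] E) → (F →L[ℂ] F)) : Prop :=
  ∀ 𝒜 : Set (E →L[ℂ] E), 𝒜 ⊆ posTC E → ContOn qEntropy 𝒜 →
    ContOn (fun A => qEntropy (Φf A)) 𝒜

/-- `μ` is the sequence of nonzero eigenvalues (with multiplicities, possibly padded by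
zeros) of the diagonalizable positive operator `T`, every vector orthogonal to the
eigenvectors being annihilated by `T`. -/
def IsEigenSeq (T : E →L[ℂ] E) (μ : ℕ → ℝ) : Prop :=
  ∃ e : ℕ → E,
    (∀ i j, i ≠ j → (inner ℂ (e i) (e j) : ℂ) = 0) ∧
    (∀ i, (μ i ≠ 0 → ‖e i‖ = 1) ∧ (μ i = 0 → e i = 0)) ∧
    (∀ i, T (e i) = (μ i : ℂ) • e i) ∧
    (∀ x : E, (∀ i, (inner ℂ (e i) x : ℂ) = 0) → T x = 0)

/-- `ν` is the sequence of singular values of `V` (eigenvalues of `√(V*V)`,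
equivalently `ν²` are the eigenvalues of `V*V`). -/
def IsSingularValues (V : E →L[ℂ] F) (ν : ℕ → ℝ) : Prop :=
  (∀ i, 0 ≤ ν i) ∧ IsEigenSeq (ContinuousLinearMap.adjoint V ∘L V) (fun i => ν i ^ 2)

/-- `∑ᵢ e^{−l/νᵢ²}`, the sum being taken over the indices with `νᵢ ≠ 0`. -/
def expSum (ν : ℕ → ℝ) (l : ℝ) : ℝ≥0∞ :=
  ∑' i, if ν i = 0 then 0 else ENNReal.ofReal (Real.exp (-(l / ν i ^ 2)))

/-- `λ*(V) < ∞`: `V` is compact (automatic here) and `∑ᵢ e^{−l/νᵢ²} < ∞` for some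
`l > 0`, where `{νᵢ}` are the singular values of `V`. -/
def LamStarFin (V : E →L[ℂ] F) : Prop :=
  ∃ ν : ℕ → ℝ, IsSingularValues V ν ∧ ∃ l : ℝ, 0 < l ∧ expSum ν l ≠ ∞

/-- `λ*(√S) < ∞` for a positive operator `S` (the singular values of `√S` are the
square roots of the eigenvalues of `S`). -/
def LamStarSqrtFin (S : E →L[ℂ] E) : Prop :=
  ∃ ν : ℕ → ℝ, (∀ i, 0 ≤ ν i) ∧ IsEigenSeq S (fun i => ν i ^ 2) ∧
    ∃ l : ℝ, 0 < l ∧ expSum ν l ≠ ∞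

/-- The value `λ*` associated to a sequence `ν` of singular values: the unique solution
of `∑ᵢ e^{−λ/νᵢ²} = 1` if it exists, and `inf{λ > 0 | ∑ᵢ e^{−λ/νᵢ²} < ∞}` otherwise. -/
def lamStarOf (ν : ℕ → ℝ) : ℝ≥0∞ :=
  if h : ∃ l : ℝ, expSum ν l = 1 then ENNReal.ofReal h.choose
  else ⨅ (l : ℝ) (_ : 0 < l ∧ expSum ν l ≠ ∞), ENNReal.ofReal l

/-- The parameter `λ*(V) ∈ [0,∞]` of a bounded operator `V`. -/
def lamStar (V : E →L[ℂ] F) : ℝ≥0∞ :=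
  if h : ∃ ν : ℕ → ℝ, IsSingularValues V ν then lamStarOf h.choose else ∞

/-- `rank A ≤ k`. -/
def rankLE (A : E →L[ℂ] E) (k : ℕ) : Prop :=
  Module.rank ℂ (LinearMap.range (A : E →ₗ[ℂ] E)) ≤ k

/-- The set `𝔗₊ᵏ(E)` of positive (trace-class) operators of rank at most `k`. -/
def rankCone (E : Type*) [NormedAddCommGroup E] [InnerProductSpace ℂ E] [CompleteSpace E]
    (k : ℕ) : Set (E →L[ℂ] E) := {A | A.IsPositive ∧ rankLE A k}

/-- A decomposition of `A` into a countable convex combination of positive operators of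
rank at most `k`. -/
structure Decomp (k : ℕ) (A : E →L[ℂ] E) where
  π : ℕ → ℝ
  op : ℕ → (E →L[ℂ] E)
  π_nonneg : ∀ i, 0 ≤ π i
  π_sum : HasSum π 1
  op_pos : ∀ i, (op i).IsPositive
  op_rank : ∀ i, rankLE (op i) k
  sum_eq : HasSum (fun i => π i • op i) A

/-- The `k`-order approximator `H_Φᵏ` of the output entropy of `Φ`. -/
def kApprox (Φf : (E →L[ℂ] E) → (F →L[ℂ] F)) (k : ℕ) (A : E →L[ℂ] E) : ℝ≥0∞ :=
  ⨆ d : Decomp k A, ∑' i, ENNReal.ofReal (d.π i) * qEntropy (Φf (d.op i))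

/-- The set of pure states (extreme points of `𝔖(E)`). -/
def pureStates (E : Type*) [NormedAddCommGroup E] [InnerProductSpace ℂ E]
    [CompleteSpace E] : Set (E →L[ℂ] E) := {A | ∃ x : E, ‖x‖ = 1 ∧ A = rankOne x}

end Defs2

section Tensor

variable (E F G : Type*)
variable [NormedAddCommGroup E] [InnerProductSpace ℂ E] [CompleteSpace E]
variable [NormedAddCommGroup F] [InnerProductSpace ℂ F] [CompleteSpace F]
variable [NormedAddCommGroup G] [InnerProductSpace ℂ G] [CompleteSpace G]

/-- A realization of `G` as the Hilbert tensor product `E ⊗ F`, together with the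
tensor product of (bounded) operators. -/
structure TensorData where
  tmul : E → F → G
  add_left : ∀ x y z, tmul (x + y) z = tmul x z + tmul y z
  add_right : ∀ x y z, tmul x (y + z) = tmul x y + tmul x z
  smul_left : ∀ (c : ℂ) x y, tmul (c • x) y = c • tmul x y
  smul_right : ∀ (c : ℂ) x y, tmul x (c • y) = c • tmul x y
  inner_tmul : ∀ x x' y y',
    (inner ℂ (tmul x y) (tmul x' y') : ℂ) = (inner ℂ x x' : ℂ) * (inner ℂ y y' : ℂ)
  dense_span : Dense ((Submodule.span ℂ {z | ∃ x y, z = tmul x y} : Submodule ℂ G) : Set G)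
  omul : (E →L[ℂ] E) → (F →L[ℂ] F) → (G →L[ℂ] G)
  omul_tmul : ∀ A B x y, omul A B (tmul x y) = tmul (A x) (B y)

end Tensor

set_option linter.unusedSectionVars false

section Hilbert

variable {E : Type*} [NormedAddCommGroup E] [InnerProductSpace ℂ E] [CompleteSpace E]

theorem IsONB.exists_hilbertBasis {s : Set E} (hs : IsONB s) :
    ∃ b : HilbertBasis s ℂ E, ∀ v : s, b v = v := by
  refine ⟨HilbertBasis.mk hs.1 ?_, fun v => ?_⟩
  · rw [Subtype.range_coe, top_le_iff]
    exact Submodule.dense_iff_topologicalClosure_eq_top.1 hs.2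
  · rw [HilbertBasis.coe_mk]

theorem IsONB.norm_eq_one {s : Set E} (hs : IsONB s) (v : s) : ‖(v : E)‖ = 1 := hs.1.1 v

theorem IsONB.hasSum_norm_sq {s : Set E} (hs : IsONB s) (x : E) :
    HasSum (fun v : s => ‖(inner ℂ (v : E) x : ℂ)‖ ^ 2) (‖x‖ ^ 2) := by
  obtain ⟨b, hb⟩ := hs.exists_hilbertBasis
  have h := (Complex.hasSum_re (b.hasSum_inner_mul_inner x x))
  have h2 : (inner ℂ x x : ℂ).re = ‖x‖ ^ 2 := by
    rw [← RCLike.re_eq_complex_re, inner_self_eq_norm_sq]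
  rw [h2] at h
  convert h using 2 with v
  have h3 := inner_mul_symm_re_eq_norm (𝕜 := ℂ) x (v : E)
  rw [hb, ← RCLike.re_eq_complex_re, h3, norm_mul, norm_inner_symm x, sq]

theorem IsONB.tsum_ofReal_norm_sq {s : Set E} (hs : IsONB s) (x : E) :
    ∑' v : s, ENNReal.ofReal (‖(inner ℂ (v : E) x : ℂ)‖ ^ 2) = ENNReal.ofReal (‖x‖ ^ 2) := by
  rw [← ENNReal.ofReal_tsum_of_nonneg (fun _ => by positivity) (hs.hasSum_norm_sq x).summable,
    (hs.hasSum_norm_sq x).tsum_eq]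

theorem qf_nonneg {A : E →L[ℂ] E} (hA : A.IsPositive) (x : E) : 0 ≤ qf A x :=
  hA.re_inner_nonneg_right x

theorem qf_add (A B : E →L[ℂ] E) (x : E) : qf (A + B) x = qf A x + qf B x := by
  simp [qf]

theorem qf_sub (A B : E →L[ℂ] E) (x : E) : qf (A - B) x = qf A x - qf B x := by
  simp [qf]

theorem qf_smul (c : ℝ) (A : E →L[ℂ] E) (x : E) : qf (c • A) x = c * qf A x := by
  have h : (c • A) x = (c : ℂ) • A x := by simp
  rw [qf, h, inner_smul_right, Complex.re_ofReal_mul, qf]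

/-- A positive operator is the square of a symmetric one. -/
theorem exists_sqrt {A : E →L[ℂ] E} (hA : A.IsPositive) :
    ∃ B : E →L[ℂ] E, (∀ x y, (inner ℂ (B x) y : ℂ) = inner ℂ x (B y)) ∧
      (∀ x, B (B x) = A x) ∧ ∀ x, qf A x = ‖B x‖ ^ 2 := by
  have h0 : 0 ≤ A := (ContinuousLinearMap.nonneg_iff_isPositive A).2 hA
  have hB : (CFC.sqrt A).IsPositive :=
    (ContinuousLinearMap.nonneg_iff_isPositive _).1 (CFC.sqrt_nonneg A)
  have hsq : ∀ x, CFC.sqrt A (CFC.sqrt A x) = A x := fun x => by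
    conv_rhs => rw [← CFC.sqrt_mul_sqrt_self A h0]
    rfl
  refine ⟨CFC.sqrt A, fun x y => hB.inner_left_eq_inner_right x y, hsq, fun x => ?_⟩
  rw [qf, ← hsq, ← hB.inner_left_eq_inner_right, ← RCLike.re_eq_complex_re,
    inner_self_eq_norm_sq]

theorem sum_qf_le_traceENN {A : E →L[ℂ] E} {ι : Type*} (t : Finset ι) {e : ι → E}
    (he : Orthonormal ℂ e) : ∑ i ∈ t, ENNReal.ofReal (qf A (e i)) ≤ traceENN A := by
  let g : Fin t.card → ι := fun i => (t.equivFin.symm i : ι)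
  have hg : Function.Injective g := Subtype.val_injective.comp t.equivFin.symm.injective
  have h : ∑ i ∈ t, ENNReal.ofReal (qf A (e i)) =
      ∑ i, ENNReal.ofReal (qf A ((e ∘ g) i)) := by
    rw [← Finset.sum_coe_sort t, ← t.equivFin.symm.sum_comp]
    rfl
  rw [h]
  exact le_iSup_of_le t.card (le_iSup_of_le (e ∘ g) (le_iSup_of_le (he.comp g hg) le_rfl))

theorem sum_norm_inner_le_traceNorm {A : E →L[ℂ] E} {ι : Type*} (t : Finset ι) {e : ι → E}
    (he : Orthonormal ℂ e) :
    ∑ i ∈ t, ENNReal.ofReal ‖(inner ℂ (e i) (A (e i)) : ℂ)‖ ≤ traceNorm A := by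
  let g : Fin t.card → ι := fun i => (t.equivFin.symm i : ι)
  have hg : Function.Injective g := Subtype.val_injective.comp t.equivFin.symm.injective
  have h : ∑ i ∈ t, ENNReal.ofReal ‖(inner ℂ (e i) (A (e i)) : ℂ)‖ =
      ∑ i, ENNReal.ofReal ‖(inner ℂ ((e ∘ g) i) (A ((e ∘ g) i)) : ℂ)‖ := by
    rw [← Finset.sum_coe_sort t, ← t.equivFin.symm.sum_comp]
    rfl
  rw [h]
  exact le_iSup_of_le t.card (le_iSup_of_le (e ∘ g) (le_iSup_of_le (e ∘ g)
    (le_iSup_of_le (he.comp g hg) (le_iSup_of_le (he.comp g hg) le_rfl))))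

/-- The trace of a positive operator can be computed in any orthonormal basis. -/
theorem tsum_qf_eq_traceENN {A : E →L[ℂ] E} (hA : A.IsPositive) {s : Set E} (hs : IsONB s) :
    ∑' v : s, ENNReal.ofReal (qf A v) = traceENN A := by
  apply le_antisymm
  · exact ENNReal.summable.tsum_le_of_sum_le fun t => sum_qf_le_traceENN t hs.1
  · refine iSup_le fun n => iSup_le fun e => iSup_le fun he => ?_
    obtain ⟨B, hsym, -, hB⟩ := exists_sqrt hA
    calc ∑ i, ENNReal.ofReal (qf A (e i))
        = ∑ i, ∑' v : s, ENNReal.ofReal (‖(inner ℂ (v : E) (B (e i)) : ℂ)‖ ^ 2) := by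
          simp_rw [hs.tsum_ofReal_norm_sq, hB]
      _ = ∑' v : s, ∑ i, ENNReal.ofReal (‖(inner ℂ (v : E) (B (e i)) : ℂ)‖ ^ 2) :=
          (Summable.tsum_finsetSum fun _ _ => ENNReal.summable).symm
      _ ≤ ∑' v : s, ENNReal.ofReal (qf A v) := by
          refine ENNReal.tsum_le_tsum fun v => ?_
          rw [← ENNReal.ofReal_sum_of_nonneg fun _ _ => by positivity, hB]
          refine ENNReal.ofReal_le_ofReal ?_
          have := he.sum_inner_products_le (B v) (s := Finset.univ)
          refine le_trans (le_of_eq (Finset.sum_congr rfl fun i _ => ?_)) this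
          rw [← hsym, norm_inner_symm]

theorem norm_inner_apply_le {A : E →L[ℂ] E} (hA : A.IsPositive) (x y : E) :
    ‖(inner ℂ x (A y) : ℂ)‖ ≤ (qf A x + qf A y) / 2 := by
  obtain ⟨B, hsym, hsq, hB⟩ := exists_sqrt hA
  rw [← hsq, ← hsym, hB, hB]
  refine (norm_inner_le_norm _ _).trans ?_
  nlinarith [sq_nonneg (‖B x‖ - ‖B y‖)]

theorem traceNorm_le_traceENN {A : E →L[ℂ] E} (hA : A.IsPositive) :
    traceNorm A ≤ traceENN A := by
  refine iSup_le fun n => iSup_le fun e => iSup_le fun f => iSup_le fun he => iSup_le fun hf => ?_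
  have h1 : ∑ i, ENNReal.ofReal (qf A (e i)) ≤ traceENN A := sum_qf_le_traceENN _ he
  have h2 : ∑ i, ENNReal.ofReal (qf A (f i)) ≤ traceENN A := sum_qf_le_traceENN _ hf
  calc ∑ i, ENNReal.ofReal ‖(inner ℂ (e i) (A (f i)) : ℂ)‖
      ≤ ∑ i, (ENNReal.ofReal (qf A (e i)) + ENNReal.ofReal (qf A (f i))) / 2 := by
        refine Finset.sum_le_sum fun i _ => ?_
        rw [← ENNReal.ofReal_add (qf_nonneg hA _) (qf_nonneg hA _),
          ← ENNReal.ofReal_ofNat 2, ← ENNReal.ofReal_div_of_pos two_pos]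
        exact ENNReal.ofReal_le_ofReal (norm_inner_apply_le hA _ _)
    _ ≤ (traceENN A + traceENN A) / 2 := by
        simp_rw [div_eq_mul_inv]
        rw [← Finset.sum_mul, Finset.sum_add_distrib]
        gcongr
    _ = traceENN A := by
        rw [← two_mul, mul_comm, mul_div_assoc, ENNReal.div_self two_ne_zero ENNReal.ofNat_ne_top,
          mul_one]

theorem isTC_of_isPositive {A : E →L[ℂ] E} (hA : A.IsPositive) (h : traceENN A ≠ ∞) : IsTC A :=
  ne_top_of_le_ne_top h (traceNorm_le_traceENN hA)

theorem qf_le_of_traceENN_le {A : E →L[ℂ] E} {c : ℝ} (hc : 0 ≤ c)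
    (h : traceENN A ≤ ENNReal.ofReal c) {x : E} (hx : ‖x‖ = 1) : qf A x ≤ c := by
  have h1 : Orthonormal ℂ (fun _ : Unit => x) :=
    ⟨fun _ => hx, fun i j hij => (hij (Subsingleton.elim i j)).elim⟩
  have h2 := (sum_qf_le_traceENN (A := A) Finset.univ h1).trans h
  simpa [ENNReal.ofReal_le_ofReal_iff hc] using h2

/-- A positive operator with finite trace is compact. -/
theorem isCompactOperator_of_traceENN {A : E →L[ℂ] E} (hA : A.IsPositive)
    (h : traceENN A ≠ ∞) : IsCompactOperator A := by
  have hcl := isClosed_setOfPred_isCompactOperator (𝕜₁ := ℂ) (𝕜₂ := ℂ) (σ₁₂ := RingHom.id ℂ)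
    (M₁ := E) (M₂ := E)
  have hmem : A ∈ closure {f : E →L[ℂ] E | IsCompactOperator f} := by
    rw [Metric.mem_closure_iff]
    intro ε hε
    obtain ⟨B, hsym, hsq, hB⟩ := exists_sqrt hA
    -- choose a finite orthonormal family carrying almost all of the trace
    set c : ℝ := (ε / 2 / (‖B‖ + 1)) ^ 2 with hc
    have hcpos : 0 < c := by positivity
    obtain ⟨n, e, he, hlt⟩ : ∃ (n : ℕ) (e : Fin n → E), Orthonormal ℂ e ∧
        traceENN A ≤ ∑ i, ENNReal.ofReal (qf A (e i)) + ENNReal.ofReal c := by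
      by_cases h0 : traceENN A = 0
      · exact ⟨0, Fin.elim0, ⟨fun i => i.elim0, fun i => i.elim0⟩, by simp [h0]⟩
      have : traceENN A - ENNReal.ofReal c < traceENN A :=
        ENNReal.sub_lt_self h h0 (by simpa using hcpos)
      conv_rhs at this => rw [traceENN]
      simp only [lt_iSup_iff] at this
      obtain ⟨n, e, he, hlt⟩ := this
      exact ⟨n, e, he, tsub_le_iff_right.1 hlt.le⟩
    let K : Submodule ℂ E := Submodule.span ℂ (Set.range e)
    have : FiniteDimensional ℂ K := FiniteDimensional.span_of_finite ℂ (Set.finite_range e)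
    have hort : ∀ y ∈ Kᗮ, ‖B y‖ ≤ ε / 2 / (‖B‖ + 1) * ‖y‖ := by
      intro y hy
      rcases eq_or_ne y 0 with rfl | hy0
      · simp
      have hn : ‖y‖ ≠ 0 := norm_ne_zero_iff.2 hy0
      set z : E := ((‖y‖⁻¹ : ℝ) : ℂ) • y with hz
      have hznorm : ‖z‖ = 1 := by
        rw [hz, norm_smul, Complex.norm_real, norm_inv, norm_norm, inv_mul_cancel₀ hn]
      have hzort : ∀ i, (inner ℂ (e i) z : ℂ) = 0 := fun i => by
        rw [hz, inner_smul_right,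
          (Submodule.mem_orthogonal _ _).1 hy _ (Submodule.subset_span ⟨i, rfl⟩), mul_zero]
      have hopt : Orthonormal ℂ (fun o : Option (Fin n) => o.elim z e) := by
        refine ⟨fun o => by cases o <;> simp [hznorm, he.1], fun o o' hoo => ?_⟩
        cases o with
        | none => cases o' with
          | none => exact (hoo rfl).elim
          | some j => simpa using inner_eq_zero_symm.1 (hzort j)
        | some i => cases o' with
          | none => simpa using hzort i
          | some j => simpa using he.2 (fun h => hoo (by rw [h]))
      have h1 := sum_qf_le_traceENN (A := A) Finset.univ hopt
      rw [Fintype.sum_option] at h1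
      have h2 := h1.trans hlt
      simp only [Option.elim] at h2
      rw [add_comm] at h2
      have hfin : ∑ i, ENNReal.ofReal (qf A (e i)) ≠ ∞ := by simp
      have h3 := (ENNReal.add_le_add_iff_left hfin).1 h2
      rw [ENNReal.ofReal_le_ofReal_iff hcpos.le, hB, hc] at h3
      have h4 := abs_le_of_sq_le_sq h3 (by positivity)
      have h5 : ‖B z‖ = ‖y‖⁻¹ * ‖B y‖ := by
        rw [hz, map_smul, norm_smul, Complex.norm_real, norm_inv, norm_norm]
      have h6 := (le_abs_self _).trans h4
      rw [h5] at h6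
      calc ‖B y‖ = ‖y‖⁻¹ * ‖B y‖ * ‖y‖ := by field_simp
        _ ≤ _ := by gcongr
    refine ⟨A ∘L K.starProjection, ?_, ?_⟩
    · have : IsCompactOperator K.starProjection := by
        have : ProperSpace K := FiniteDimensional.proper ℂ K
        exact (isCompactOperator_of_locallyCompactSpace_dom
          K.orthogonalProjectionOnto).clm_comp K.subtypeL
      exact this.clm_comp A
    · rw [dist_eq_norm]
      refine lt_of_le_of_lt (ContinuousLinearMap.opNorm_le_bound _ (half_pos hε).le fun x => ?_)
        (half_lt_self hε)
      set y := x - K.starProjection x with hy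
      have hyK : y ∈ Kᗮ := K.sub_starProjection_mem_orthogonal x
      have hyx : ‖y‖ ≤ ‖x‖ := by
        have := K.norm_sq_eq_add_norm_sq_starProjection x
        rw [Submodule.starProjection_orthogonal_val] at this
        refine le_of_sq_le_sq ?_ (norm_nonneg x)
        nlinarith [sq_nonneg ‖K.starProjection x‖]
      have h1 : (A - A ∘L K.starProjection) x = B (B y) := by
        rw [hsq, hy, map_sub]; rfl
      rw [h1]
      calc ‖B (B y)‖ ≤ ‖B‖ * (ε / 2 / (‖B‖ + 1) * ‖y‖) := by
            refine (B.le_opNorm _).trans ?_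
            gcongr
            exact hort y hyK
        _ ≤ (‖B‖ + 1) * (ε / 2 / (‖B‖ + 1) * ‖x‖) := by gcongr; linarith
        _ = ε / 2 * ‖x‖ := by field_simp
  rw [hcl.closure_eq] at hmem
  exact hmem

/-- A compact self-adjoint operator has an orthonormal eigenbasis. -/
theorem exists_eigenbasis {A : E →L[ℂ] E} (hA : IsCompactOperator A)
    (hsym : (A : E →ₗ[ℂ] E).IsSymmetric) :
    ∃ s : Set E, IsONB s ∧ ∀ v : s, A v = (qf A v : ℂ) • (v : E) := by
  let V : ℂ → Submodule ℂ E := fun μ => Module.End.eigenspace (A : Module.End ℂ E) μ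
  have hV : OrthogonalFamily ℂ (fun μ => V μ) fun μ => (V μ).subtypeₗᵢ :=
    hsym.orthogonalFamily_eigenspaces
  have hcomp : ∀ μ, CompleteSpace (V μ) := fun μ => by
    have : IsClosed (V μ : Set E) := by
      have : (V μ : Set E) = {x | A x = μ • x} := by
        ext x; simp [V]
      rw [this]
      exact isClosed_eq A.continuous (continuous_const_smul μ)
    exact this.completeSpace_coe
  choose w b hb using fun μ => exists_hilbertBasis ℂ (V μ)
  have horth := hV.orthonormal_sigma_orthonormal (v_family := fun μ => (b μ : w μ → V μ))
    (fun μ => (b μ).orthonormal)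
  set e : (Σ μ, w μ) → E := fun a => (V a.1).subtypeₗᵢ (b a.1 a.2) with he
  have hbot : (Submodule.span ℂ (Set.range e))ᗮ = ⊥ := by
    rw [eq_bot_iff, ← ContinuousLinearMap.orthogonalComplement_iSup_eigenspaces_eq_bot hA hsym]
    intro x hx
    rw [← Submodule.iInf_orthogonal, Submodule.mem_iInf]
    intro μ
    rw [Submodule.mem_orthogonal']
    intro y hy
    have h1 := ((b μ).hasSum_repr ⟨y, hy⟩).mapL (innerSL ℂ x ∘L (V μ).subtypeL)
    have h2 : ∀ i : w μ, (innerSL ℂ x ∘L (V μ).subtypeL)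
        ((b μ).repr ⟨y, hy⟩ i • b μ i) = 0 := fun i => by
      have h3 : (inner ℂ x (e ⟨μ, i⟩) : ℂ) = 0 :=
        (Submodule.mem_orthogonal' _ _).1 hx _ (Submodule.subset_span ⟨_, rfl⟩)
      rw [map_smul]
      refine smul_eq_zero_of_right _ ?_
      simpa [he] using h3
    simp only [h2] at h1
    simpa using h1.unique hasSum_zero
  refine ⟨Set.range e, ⟨horth.toSubtypeRange, ?_⟩, ?_⟩
  · rw [Submodule.dense_iff_topologicalClosure_eq_top, Submodule.topologicalClosure_eq_top_iff]
    exact hbot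
  · rintro ⟨_, ⟨μ, i⟩, rfl⟩
    have h1 : A (e ⟨μ, i⟩) = μ • e ⟨μ, i⟩ := Module.End.mem_eigenspace_iff.1 (b μ i).2
    have h2 : (inner ℂ (e ⟨μ, i⟩) (A (e ⟨μ, i⟩)) : ℂ) = μ := by
      rw [h1, inner_smul_right, inner_self_eq_norm_sq_to_K, horth.1]; simp
    have h3 : (qf A (e ⟨μ, i⟩) : ℂ) = μ := by
      exact (hsym.coe_re_inner_self_apply (e ⟨μ, i⟩)).trans h2
    simp only [h3, h1]

theorem exists_eigenbasis_of_traceENN {A : E →L[ℂ] E} (hA : A.IsPositive)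
    (h : traceENN A ≠ ∞) : ∃ s : Set E, IsONB s ∧ ∀ v : s, A v = (qf A v : ℂ) • (v : E) :=
  exists_eigenbasis (isCompactOperator_of_traceENN hA h) hA.isSymmetric

/-- Jordan decomposition of the difference of two positive trace-class operators. -/
theorem exists_jordan {A B : E →L[ℂ] E} (hA : A.IsPositive) (hB : B.IsPositive)
    (hA' : traceENN A ≠ ∞) (hB' : traceENN B ≠ ∞) :
    ∃ P N : E →L[ℂ] E, P.IsPositive ∧ N.IsPositive ∧ A + N = B + P ∧
      traceENN P ≤ traceNorm (A - B) ∧ traceENN N ≤ traceNorm (A - B) := by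
  have hD : IsSelfAdjoint (A - B) := hA.isSelfAdjoint.sub hB.isSelfAdjoint
  obtain ⟨s, hs, hsD⟩ := exists_eigenbasis (A := A - B)
    ((isCompactOperator_of_traceENN hA hA').sub (isCompactOperator_of_traceENN hB hB'))
    (hA.isSymmetric.sub hB.isSymmetric)
  have hP : ((A - B)⁺).IsPositive :=
    (ContinuousLinearMap.nonneg_iff_isPositive _).1 (CFC.posPart_nonneg (A - B))
  have hN : ((A - B)⁻).IsPositive :=
    (ContinuousLinearMap.nonneg_iff_isPositive _).1 (CFC.negPart_nonneg (A - B))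
  have hPN : ∀ x, (A - B)⁺ ((A - B)⁻ x) = 0 := fun x =>
    congrArg (fun T : E →L[ℂ] E => T x) (CFC.posPart_mul_negPart (A - B))
  have hNP : ∀ x, (A - B)⁻ ((A - B)⁺ x) = 0 := fun x =>
    congrArg (fun T : E →L[ℂ] E => T x) (CFC.negPart_mul_posPart (A - B))
  have hdiff := CFC.posPart_sub_negPart (A - B) hD
  generalize (A - B)⁺ = P at *
  generalize (A - B)⁻ = N at *
  have hqf : ∀ v : s, qf P v ≤ |qf (A - B) v| ∧ qf N v ≤ |qf (A - B) v| := by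
    intro v
    have hv : P v - N v = (qf (A - B) v : ℂ) • (v : E) := by
      rw [← hsD v, ← hdiff]; rfl
    have hq : qf (A - B) v = qf P v - qf N v := by rw [← qf_sub, hdiff]
    have h1 : ‖P v‖ ^ 2 = qf (A - B) v * qf P v := by
      have h2 : P (P v) = (qf (A - B) v : ℂ) • P v := by
        rw [← map_smul, ← hv, map_sub, hPN, sub_zero]
      rw [← inner_self_eq_norm_sq (𝕜 := ℂ), hP.inner_left_eq_inner_right, h2, inner_smul_right,
        RCLike.re_eq_complex_re, Complex.re_ofReal_mul, qf, qf]
    have h2 : ‖N v‖ ^ 2 = -(qf (A - B) v * qf N v) := by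
      have h2 : N (N v) = -((qf (A - B) v : ℂ) • N v) := by
        rw [← map_smul, ← hv, map_sub, hNP, zero_sub, neg_neg]
      rw [← inner_self_eq_norm_sq (𝕜 := ℂ), hN.inner_left_eq_inner_right, h2, inner_neg_right,
        inner_smul_right, map_neg, RCLike.re_eq_complex_re, Complex.re_ofReal_mul, qf, qf]
    have hP0 := qf_nonneg hP v
    have hN0 := qf_nonneg hN v
    rcases le_or_gt (qf (A - B) v) 0 with hd | hd
    · have h3 : P v = 0 := by
        rw [← norm_eq_zero, ← sq_eq_zero_iff]
        exact le_antisymm (h1 ▸ mul_nonpos_of_nonpos_of_nonneg hd hP0) (sq_nonneg _)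
      have h4 : qf P v = 0 := by simp [qf, h3]
      rw [abs_of_nonpos hd]
      constructor <;> linarith
    · have h3 : N v = 0 := by
        rw [← norm_eq_zero, ← sq_eq_zero_iff]
        exact le_antisymm (by rw [h2]; nlinarith) (sq_nonneg _)
      have h4 : qf N v = 0 := by simp [qf, h3]
      rw [abs_of_pos hd]
      constructor <;> linarith
  have hle : ∀ T : E →L[ℂ] E, T.IsPositive → (∀ v : s, qf T v ≤ |qf (A - B) v|) →
      traceENN T ≤ traceNorm (A - B) := fun T hT h => by
    rw [← tsum_qf_eq_traceENN hT hs]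
    refine ENNReal.summable.tsum_le_of_sum_le fun t => ?_
    refine le_trans (Finset.sum_le_sum fun v _ => ?_) (sum_norm_inner_le_traceNorm t hs.1)
    exact ENNReal.ofReal_le_ofReal ((h v).trans (Complex.abs_re_le_norm _))
  refine ⟨P, N, hP, hN, ?_, hle P hP fun v => (hqf v).1, hle N hN fun v => (hqf v).2⟩
  have : A = B + (P - N) := by rw [hdiff]; abel
  rw [this]; abel

end Hilbert

section ScalarFunctions

/-- Nonnegative functions on `[0,1]` vanishing at zero and having supporting lines from above at
every point of `(0,1]`. -/
def IsConcaveGauge (f : ℝ → ℝ) : Prop :=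
  f 0 = 0 ∧ (∀ x ∈ Set.Icc (0 : ℝ) 1, 0 ≤ f x) ∧
    ∀ m ∈ Set.Ioc (0 : ℝ) 1, ∃ κ : ℝ, ∀ x ∈ Set.Icc (0 : ℝ) 1, f x ≤ f m + κ * (x - m)

/-- The function `−x log x + 2x`, nondecreasing on `[0,2]`. -/
def entFun (x : ℝ) : ℝ := Real.negMulLog x + 2 * x

/-- The Lipschitz part of `entFun`. -/
def headFun (δ x : ℝ) : ℝ := entFun (x + δ) - entFun δ

/-- The remainder of `entFun` after removing its Lipschitz part `headFun δ`. -/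
def tailFun (δ x : ℝ) : ℝ := entFun x + entFun δ - entFun (x + δ)

theorem tailFun_add_headFun (δ x : ℝ) : tailFun δ x + headFun δ x = entFun x := by
  simp only [tailFun, headFun]; ring

theorem tailFun_comm (δ x : ℝ) : tailFun δ x = tailFun x δ := by
  simp only [tailFun]; rw [add_comm x δ]; ring

@[simp] theorem entFun_zero : entFun 0 = 0 := by simp [entFun]

@[simp] theorem tailFun_zero (δ : ℝ) : tailFun δ 0 = 0 := by simp [tailFun]

@[simp] theorem headFun_zero (δ : ℝ) : headFun δ 0 = 0 := by simp [headFun]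

theorem continuous_entFun : Continuous entFun :=
  Real.continuous_negMulLog.add (continuous_const.mul continuous_id)

theorem entFun_le {x m : ℝ} (hx : 0 ≤ x) (hm : 0 < m) :
    entFun x ≤ entFun m + (1 - Real.log m) * (x - m) := by
  rcases hx.eq_or_lt with rfl | hx
  · simp only [entFun, Real.negMulLog]; nlinarith
  · have h := Real.log_le_sub_one_of_pos (div_pos hm hx)
    rw [Real.log_div hm.ne' hx.ne'] at h
    have h2 := mul_le_mul_of_nonneg_left h hx.le
    have h3 : x * (m / x - 1) = m - x := by field_simp
    simp only [entFun, Real.negMulLog]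
    nlinarith

theorem log_le_one {y : ℝ} (hy0 : 0 < y) (hy : y ≤ 2) : Real.log y ≤ 1 := by
  have := Real.log_le_sub_one_of_pos hy0
  linarith

theorem entFun_mono {x y : ℝ} (hx : 0 ≤ x) (hxy : x ≤ y) (hy : y ≤ 2) : entFun x ≤ entFun y := by
  rcases (hx.trans hxy).eq_or_lt with h | h
  · rw [le_antisymm hxy (h ▸ hx)]
  · have h1 := entFun_le hx h
    have h2 := log_le_one h hy
    nlinarith

theorem isConcaveGauge_entFun : IsConcaveGauge entFun :=
  ⟨entFun_zero, fun x hx => by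
      simpa using entFun_mono le_rfl hx.1 (hx.2.trans one_le_two),
    fun m hm => ⟨1 - Real.log m, fun x hx => entFun_le hx.1 hm.1⟩⟩

theorem headFun_le {δ x m : ℝ} (hδ : 0 < δ) (hx : 0 ≤ x) (hm : 0 ≤ m) :
    headFun δ x ≤ headFun δ m + (1 - Real.log (m + δ)) * (x - m) := by
  have := entFun_le (x := x + δ) (m := m + δ) (by positivity) (by positivity)
  simp only [headFun]
  linarith

theorem headFun_mono {δ x y : ℝ} (hδ : δ ∈ Set.Ioc (0 : ℝ) 1) (hx : 0 ≤ x) (hxy : x ≤ y)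
    (hy : y ≤ 1) : headFun δ x ≤ headFun δ y := by
  have := entFun_mono (x := x + δ) (y := y + δ) (by linarith [hδ.1]) (by linarith)
    (by linarith [hδ.2])
  simp only [headFun]
  linarith

theorem isConcaveGauge_headFun {δ : ℝ} (hδ : δ ∈ Set.Ioc (0 : ℝ) 1) :
    IsConcaveGauge (headFun δ) :=
  ⟨headFun_zero δ, fun x hx => by simpa using headFun_mono hδ le_rfl hx.1 hx.2,
    fun m hm => ⟨1 - Real.log (m + δ), fun x hx => headFun_le hδ.1 hx.1 hm.1.le⟩⟩

theorem headFun_le_add {δ x y : ℝ} (hδ : δ ∈ Set.Ioc (0 : ℝ) 1)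
    (hx : x ∈ Set.Icc (0 : ℝ) 1) (hy : y ∈ Set.Icc (0 : ℝ) 1) :
    headFun δ x ≤ headFun δ y + (1 - Real.log δ) * |x - y| := by
  have hL : 0 ≤ 1 - Real.log δ := by
    have := Real.log_nonpos hδ.1.le hδ.2
    linarith
  rcases le_total x y with h | h
  · have h1 := headFun_mono hδ hx.1 h hy.2
    have := mul_nonneg hL (abs_nonneg (x - y))
    linarith
  · rw [abs_of_nonneg (sub_nonneg.2 h)]
    have h1 := headFun_le hδ.1 hx.1 hy.1
    have h2 := Real.log_le_log hδ.1 (show δ ≤ y + δ by linarith [hy.1])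
    nlinarith [mul_nonneg (sub_nonneg.2 h2) (sub_nonneg.2 h)]

theorem tailFun_le {δ x m : ℝ} (hδ : 0 < δ) (hx : 0 ≤ x) (hm : 0 < m) :
    tailFun δ x ≤ tailFun δ m + (Real.log (m + δ) - Real.log m) * (x - m) := by
  have hmd : 0 < m + δ := by positivity
  have hxd : 0 < x + δ := by positivity
  -- the log-sum inequality, obtained from two tangent lines
  set r := (m + δ) / (x + δ) with hr
  have hr0 : 0 < r := by positivity
  have hlr : Real.log r = Real.log (m + δ) - Real.log (x + δ) := Real.log_div hmd.ne' hxd.ne'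
  have h1 : δ * (1 - r⁻¹) ≤ δ * Real.log r :=
    mul_le_mul_of_nonneg_left (Real.one_sub_inv_le_log_of_pos hr0) hδ.le
  have hrr : r⁻¹ * (m + δ) = x + δ := by rw [hr]; field_simp
  have h2 : x - m * r⁻¹ ≤ x * Real.log x - x * Real.log m + x * Real.log r := by
    rcases hx.eq_or_lt with rfl | hx
    · simp only [zero_sub, zero_mul, sub_zero, add_zero, Left.neg_nonpos_iff]; positivity
    · have h3 := Real.one_sub_inv_le_log_of_pos (show 0 < x / m * r by positivity)
      rw [Real.log_mul (by positivity) hr0.ne', Real.log_div hx.ne' hm.ne'] at h3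
      have h4 := mul_le_mul_of_nonneg_left h3 hx.le
      have h5 : x * (1 - (x / m * r)⁻¹) = x - m * r⁻¹ := by field_simp
      linarith
  rw [hlr] at h1 h2
  simp only [tailFun, entFun, Real.negMulLog]
  nlinarith

theorem tailFun_mono {δ x y : ℝ} (hδ : 0 < δ) (hx : 0 ≤ x) (hxy : x ≤ y) :
    tailFun δ x ≤ tailFun δ y := by
  rcases (hx.trans hxy).eq_or_lt with h | h
  · rw [le_antisymm hxy (h ▸ hx)]
  · have h1 := tailFun_le hδ hx h
    have h2 := Real.log_le_log h (show y ≤ y + δ by linarith)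
    nlinarith

theorem tailFun_mono_left {δ δ' x : ℝ} (hδ : 0 < δ) (h : δ ≤ δ') (hx : 0 ≤ x) :
    tailFun δ x ≤ tailFun δ' x := by
  rcases hx.eq_or_lt with rfl | hx
  · simp
  · rw [tailFun_comm, tailFun_comm δ']
    exact tailFun_mono hx hδ.le h

theorem tailFun_nonneg {δ x : ℝ} (hδ : 0 < δ) (hx : 0 ≤ x) : 0 ≤ tailFun δ x := by
  simpa using tailFun_mono hδ le_rfl hx

theorem isConcaveGauge_tailFun {δ : ℝ} (hδ : 0 < δ) : IsConcaveGauge (tailFun δ) :=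
  ⟨tailFun_zero δ, fun _ hx => tailFun_nonneg hδ hx.1,
    fun _ hm => ⟨_, fun _ hx => tailFun_le hδ hx.1 hm.1⟩⟩

theorem tailFun_le_entFun {δ x : ℝ} (hδ : δ ∈ Set.Ioc (0 : ℝ) 1) (hx : x ∈ Set.Icc (0 : ℝ) 1) :
    tailFun δ x ≤ entFun x := by
  have h1 := (isConcaveGauge_headFun hδ).2.1 x hx
  have h2 := tailFun_add_headFun δ x
  linarith

theorem tendsto_tailFun (x : ℝ) : Tendsto (fun δ => tailFun δ x) (𝓝[>] 0) (𝓝 0) := by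
  have h : Continuous fun δ => tailFun δ x := by
    simp only [tailFun]
    exact (continuous_const.add continuous_entFun).sub
      (continuous_entFun.comp (continuous_const.add continuous_id))
  have h1 := (h.tendsto 0).mono_left (nhdsWithin_le_nhds (s := Set.Ioi 0))
  simpa [tailFun] using h1

end ScalarFunctions

section Majorization

theorem hasSum_congr {κ : Type*} {f g : κ → ℝ} {a : ℝ} (h : ∀ k, f k = g k) :
    HasSum f a ↔ HasSum g a := by
  rw [funext h]

/-- Jensen's inequality for sub-probability weights. -/
theorem IsConcaveGauge.tsum_le {f : ℝ → ℝ} (hf : IsConcaveGauge f) {κ : Type*} {p c : κ → ℝ}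
    (hp : ∀ k, 0 ≤ p k) (hc : ∀ k, c k ∈ Set.Icc (0 : ℝ) 1) (hps : Summable p)
    (hp1 : ∑' k, p k ≤ 1) {m : ℝ} (hm : HasSum (fun k => p k * c k) m) :
    ∑' k, ENNReal.ofReal (p k * f (c k)) ≤ ENNReal.ofReal (f m) := by
  obtain ⟨hf0, hfn, hfs⟩ := hf
  have hm0 : 0 ≤ m := hm.nonneg fun k => mul_nonneg (hp k) (hc k).1
  have hm1 : m ≤ 1 := (hasSum_le (fun k => mul_le_of_le_one_right (hp k) (hc k).2) hm
    hps.hasSum).trans hp1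
  rcases hm0.eq_or_lt with rfl | hmpos
  · have h0 := (hasSum_zero_iff_of_nonneg fun k => mul_nonneg (hp k) (hc k).1).1 hm
    have : ∀ k, p k * f (c k) = 0 := fun k => by
      rcases mul_eq_zero.1 (congrFun h0 k) with h | h
      · rw [h, zero_mul]
      · rw [h, hf0, mul_zero]
    simp [this]
  · obtain ⟨q, hq⟩ := hfs m ⟨hmpos, hm1⟩
    have hb : HasSum (fun k => p k * (f m - q * m) + q * (p k * c k))
        ((∑' k, p k) * (f m - q * m) + q * m) := (hps.hasSum.mul_right _).add (hm.mul_left _)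
    have hle : ∀ k, p k * f (c k) ≤ p k * (f m - q * m) + q * (p k * c k) := fun k => by
      have := mul_le_mul_of_nonneg_left (hq _ (hc k)) (hp k)
      linarith
    have hnn : ∀ k, 0 ≤ p k * f (c k) := fun k => mul_nonneg (hp k) (hfn _ (hc k))
    have hsum : Summable fun k => p k * f (c k) := .of_nonneg_of_le hnn hle hb.summable
    rw [← ENNReal.ofReal_tsum_of_nonneg hnn hsum]
    refine ENNReal.ofReal_le_ofReal ((hasSum_le hle hsum.hasSum hb).trans ?_)
    have h0 := hq 0 ⟨le_rfl, zero_le_one⟩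
    nlinarith

theorem IsConcaveGauge.tsum_le_tsum {f : ℝ → ℝ} (hf : IsConcaveGauge f) {ι κ : Type*}
    {u : ι → κ → ℝ} {c : κ → ℝ} {w : ι → ℝ} (hu : ∀ m k, 0 ≤ u m k)
    (hc : ∀ k, c k ∈ Set.Icc (0 : ℝ) 1) (hus : ∀ m, Summable (u m)) (hu1 : ∀ m, ∑' k, u m k ≤ 1)
    (hw : ∀ m, HasSum (fun k => u m k * c k) (w m))
    (hcol : ∀ k, c k ≠ 0 → 1 ≤ ∑' m, ENNReal.ofReal (u m k)) :
    ∑' k, ENNReal.ofReal (f (c k)) ≤ ∑' m, ENNReal.ofReal (f (w m)) := by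
  calc ∑' k, ENNReal.ofReal (f (c k))
      ≤ ∑' k, ∑' m, ENNReal.ofReal (u m k * f (c k)) := by
        refine ENNReal.tsum_le_tsum fun k => ?_
        by_cases hk : c k = 0
        · simp [hk, hf.1]
        · simp_rw [ENNReal.ofReal_mul (hu _ _)]
          rw [ENNReal.tsum_mul_right]
          exact le_mul_of_one_le_left' (hcol k hk)
    _ = ∑' m, ∑' k, ENNReal.ofReal (u m k * f (c k)) := ENNReal.tsum_comm
    _ ≤ _ := ENNReal.tsum_le_tsum fun m => hf.tsum_le (hu m) hc (hus m) (hu1 m) (hw m)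

end Majorization

section Diagonal

variable {E : Type*} [NormedAddCommGroup E] [InnerProductSpace ℂ E] [CompleteSpace E]

/-- The sum of the values of `f` on the diagonal of `A` in the basis `s`. -/
def diagSum (f : ℝ → ℝ) (s : Set E) (A : E →L[ℂ] E) : ℝ≥0∞ :=
  ∑' v : s, ENNReal.ofReal (f (qf A v))

/-- `s` is an orthonormal eigenbasis of `A`. -/
def IsEigenbasis (s : Set E) (A : E →L[ℂ] E) : Prop :=
  IsONB s ∧ ∀ v : s, A v = (qf A v : ℂ) • (v : E)

theorem qf_mem_Icc {A : E →L[ℂ] E} (hA : A.IsPositive) (h : traceENN A ≤ 1) {s : Set E}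
    (hs : IsONB s) (v : s) : qf A v ∈ Set.Icc (0 : ℝ) 1 :=
  ⟨qf_nonneg hA v, qf_le_of_traceENN_le zero_le_one (by simpa using h) (hs.norm_eq_one v)⟩

theorem IsEigenbasis.hasSum_qf {A : E →L[ℂ] E} (hA : A.IsPositive) {s : Set E}
    (hs : IsEigenbasis s A) (x : E) :
    HasSum (fun v : s => ‖(inner ℂ (v : E) x : ℂ)‖ ^ 2 * qf A v) (qf A x) := by
  obtain ⟨b, hb⟩ := hs.1.exists_hilbertBasis
  have h := Complex.hasSum_re (b.hasSum_inner_mul_inner x (A x))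
  refine (hasSum_congr fun v => ?_).1 h
  rw [hb, ← hA.inner_left_eq_inner_right, hs.2 v, inner_smul_left, Complex.conj_ofReal,
    mul_left_comm, Complex.re_ofReal_mul, ← RCLike.re_eq_complex_re, inner_mul_symm_re_eq_norm,
    norm_mul, norm_inner_symm x, ← sq, mul_comm]

/-- The diagonal in an eigenbasis minimizes concave diagonal sums. -/
theorem IsEigenbasis.diagSum_le {f : ℝ → ℝ} (hf : IsConcaveGauge f) {A : E →L[ℂ] E}
    (hA : A.IsPositive) (hA1 : traceENN A ≤ 1) {s t : Set E} (hs : IsEigenbasis s A)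
    (ht : IsONB t) : diagSum f s A ≤ diagSum f t A := by
  have hrow : ∀ v : t, HasSum (fun k : s => ‖(inner ℂ (k : E) (v : E) : ℂ)‖ ^ 2) 1 := fun v => by
    simpa [ht.norm_eq_one v] using hs.1.hasSum_norm_sq (v : E)
  refine hf.tsum_le_tsum (u := fun (v : t) (k : s) => ‖(inner ℂ (k : E) (v : E) : ℂ)‖ ^ 2)
    (fun _ _ => by positivity) (qf_mem_Icc hA hA1 hs.1) (fun v => (hrow v).summable)
    (fun v => (hrow v).tsum_eq.le) (fun v => hs.hasSum_qf hA v) fun k _ => ?_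
  simp_rw [norm_inner_symm (k : E)]
  rw [ht.tsum_ofReal_norm_sq, hs.1.norm_eq_one]
  simp

theorem IsEigenbasis.sum_div_le_one {C : E →L[ℂ] E} {s : Set E} (hs : IsEigenbasis s C)
    {w : ℝ} {x : E} (hx : ∀ z, w * ‖(inner ℂ x z : ℂ)‖ ^ 2 ≤ qf C z) (hw : 0 ≤ w)
    (K : Finset s) :
    ∑ k ∈ K, w * ‖(inner ℂ (k : E) x : ℂ)‖ ^ 2 / qf C k ≤ 1 := by
  set S := ∑ k ∈ K, ‖(inner ℂ (k : E) x : ℂ)‖ ^ 2 / qf C k with hS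
  have hwS : ∑ k ∈ K, w * ‖(inner ℂ (k : E) x : ℂ)‖ ^ 2 / qf C k = w * S := by
    rw [hS, Finset.mul_sum]
    exact Finset.sum_congr rfl fun k _ => mul_div_assoc _ _ _
  rw [hwS]
  set z : E := ∑ k ∈ K, (((qf C k)⁻¹ : ℝ) * inner ℂ (k : E) x : ℂ) • (k : E) with hz
  have h1 : (inner ℂ x z : ℂ) = (S : ℂ) := by
    rw [hz, inner_sum, hS, Complex.ofReal_sum]
    refine Finset.sum_congr rfl fun k _ => ?_
    rw [inner_smul_right, mul_assoc, ← inner_conj_symm x, RCLike.mul_conj]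
    push_cast
    ring_nf
    rfl
  have h2 : qf C z = S := by
    have hCz : C z = ∑ k ∈ K,
        ((((qf C k)⁻¹ : ℝ) * inner ℂ (k : E) x : ℂ) * (qf C k : ℂ)) • (k : E) := by
      rw [hz, map_sum]
      refine Finset.sum_congr rfl fun k _ => ?_
      rw [map_smul, hs.2 k, smul_smul]
    rw [qf, hCz, hz, hs.1.1.inner_sum, Complex.re_sum, hS]
    refine Finset.sum_congr rfl fun k _ => ?_
    have h3 : (starRingEnd ℂ) (((qf C k)⁻¹ : ℝ) * inner ℂ (k : E) x : ℂ) *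
        ((((qf C k)⁻¹ : ℝ) * inner ℂ (k : E) x : ℂ) * (qf C k : ℂ)) =
        (((qf C k)⁻¹ * (qf C k)⁻¹ * qf C k * ‖(inner ℂ (k : E) x : ℂ)‖ ^ 2 : ℝ) : ℂ) := by
      rw [map_mul, Complex.conj_ofReal]
      have := RCLike.conj_mul (inner ℂ (k : E) x : ℂ)
      push_cast at this ⊢
      linear_combination ((qf C k : ℂ)⁻¹ * (qf C k : ℂ)⁻¹ * (qf C k : ℂ)) * this
    rw [h3, Complex.ofReal_re]
    by_cases hk : qf C k = 0
    · simp [hk]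
    · field_simp
  have h3 := hx z
  rw [h1, h2, Complex.norm_real, Real.norm_eq_abs, sq_abs] at h3
  by_contra hcon
  push Not at hcon
  have hSpos : 0 < S := by
    by_contra h
    nlinarith
  nlinarith

theorem IsEigenbasis.mul_norm_inner_le {A B : E →L[ℂ] E} (hA : A.IsPositive) (hB : B.IsPositive)
    {s : Set E} (hs : IsEigenbasis s A) (v : s) (z : E) :
    qf A v * ‖(inner ℂ (v : E) z : ℂ)‖ ^ 2 ≤ qf (A + B) z := by
  have h1 := le_hasSum (hs.hasSum_qf hA z) v fun k _ =>
    mul_nonneg (sq_nonneg _) (qf_nonneg hA _)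
  rw [qf_add, mul_comm]
  exact h1.trans (le_add_of_nonneg_right (qf_nonneg hB z))

/-- Subadditivity of concave diagonal sums taken in eigenbases. -/
theorem IsEigenbasis.diagSum_add_le {f : ℝ → ℝ} (hf : IsConcaveGauge f) {A B : E →L[ℂ] E}
    (hA : A.IsPositive) (hB : B.IsPositive) (h1 : traceENN (A + B) ≤ 1) {r s t : Set E}
    (hr : IsEigenbasis r A) (hs : IsEigenbasis s B) (ht : IsEigenbasis t (A + B)) :
    diagSum f t (A + B) ≤ diagSum f r A + diagSum f s B := by
  have hC := hA.add hB
  let x : r ⊕ s → E := Sum.elim (fun v => (v : E)) (fun v => (v : E))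
  let w : r ⊕ s → ℝ := Sum.elim (fun v => qf A v) (fun v => qf B v)
  have hx : ∀ m z, w m * ‖(inner ℂ (x m) z : ℂ)‖ ^ 2 ≤ qf (A + B) z := by
    rintro (v | v) z
    · exact hr.mul_norm_inner_le hA hB v z
    · rw [add_comm A]
      exact hs.mul_norm_inner_le hB hA v z
  have hw : ∀ m, 0 ≤ w m := by
    rintro (v | v)
    exacts [qf_nonneg hA _, qf_nonneg hB _]
  have hxn : ∀ m, ‖x m‖ = 1 := by
    rintro (v | v)
    exacts [hr.1.norm_eq_one v, hs.1.norm_eq_one v]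
  let u : r ⊕ s → t → ℝ := fun m k => w m * ‖(inner ℂ (k : E) (x m) : ℂ)‖ ^ 2 / qf (A + B) k
  have hu : ∀ m k, 0 ≤ u m k := fun m k =>
    div_nonneg (mul_nonneg (hw m) (sq_nonneg _)) (qf_nonneg hC _)
  have hus : ∀ m, Summable (u m) := fun m =>
    summable_of_sum_le (hu m) (ht.sum_div_le_one (hx m) (hw m))
  have key := hf.tsum_le_tsum (u := u) (c := fun k : t => qf (A + B) k) (w := w) hu
    (qf_mem_Icc hC h1 ht.1) hus
    (fun m => (hus m).tsum_le_of_sum_le (ht.sum_div_le_one (hx m) (hw m))) ?_ ?_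
  · refine key.trans (le_of_eq ?_)
    exact Summable.tsum_sum ENNReal.summable ENNReal.summable
  · intro m
    have h2 := (ht.1.hasSum_norm_sq (x m)).mul_left (w m)
    rw [hxn, one_pow, mul_one] at h2
    refine (hasSum_congr fun k => ?_).2 h2
    by_cases hk : qf (A + B) k = 0
    · have h3 := hx m k
      rw [hk] at h3
      have h4 := le_antisymm h3 (mul_nonneg (hw m) (sq_nonneg _))
      rw [norm_inner_symm] at h4
      rw [hk, mul_zero, h4]
    · exact div_mul_cancel₀ _ hk
  · intro k hk
    have h2 : HasSum (fun m => u m k) 1 := by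
      have h3 := (HasSum.sum (f := fun m => w m * ‖(inner ℂ (k : E) (x m) : ℂ)‖ ^ 2)
        (a := qf A k) (b := qf B k) ?_ ?_).div_const (qf (A + B) k)
      · rwa [← qf_add, div_self hk] at h3
      · refine (hasSum_congr fun v => ?_).1 (hr.hasSum_qf hA (k : E))
        rw [mul_comm, norm_inner_symm]; rfl
      · refine (hasSum_congr fun v => ?_).1 (hs.hasSum_qf hB (k : E))
        rw [mul_comm, norm_inner_symm]; rfl
    rw [← ENNReal.ofReal_tsum_of_nonneg (fun m => hu m k) h2.summable, h2.tsum_eq]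
    simp

end Diagonal

section Entropy

variable {E : Type*} [NormedAddCommGroup E] [InnerProductSpace ℂ E] [CompleteSpace E]

theorem traceENN_add {A B : E →L[ℂ] E} (hA : A.IsPositive) (hB : B.IsPositive) :
    traceENN (A + B) = traceENN A + traceENN B := by
  obtain ⟨s, hs⟩ := exists_isONB E
  rw [← tsum_qf_eq_traceENN hA hs, ← tsum_qf_eq_traceENN hB hs,
    ← tsum_qf_eq_traceENN (hA.add hB) hs, ← ENNReal.tsum_add]
  simp_rw [qf_add, ENNReal.ofReal_add (qf_nonneg hA _) (qf_nonneg hB _)]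

theorem isPositive_real_smul {A : E →L[ℂ] E} (hA : A.IsPositive) {c : ℝ} (hc : 0 ≤ c) :
    (c • A).IsPositive := by
  have h := hA.smul_of_nonneg (c := (c : ℂ)) (by simpa using hc)
  rwa [show (c : ℂ) • A = c • A by ext; simp] at h

theorem traceENN_smul {A : E →L[ℂ] E} (hA : A.IsPositive) {c : ℝ} (hc : 0 ≤ c) :
    traceENN (c • A) = ENNReal.ofReal c * traceENN A := by
  obtain ⟨s, hs⟩ := exists_isONB E
  rw [← tsum_qf_eq_traceENN hA hs, ← tsum_qf_eq_traceENN (isPositive_real_smul hA hc) hs,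
    ← ENNReal.tsum_mul_left]
  simp_rw [qf_smul, ENNReal.ofReal_mul hc]

theorem clEntropy_mul {ι : Type*} {c : ℝ} (hc : 0 < c) (x : ι → ℝ) :
    clEntropy (fun i => c * x i) = ENNReal.ofReal c * clEntropy x := by
  simp_rw [clEntropy, tsum_mul_left, mul_div_mul_left _ _ hc.ne', ENNReal.ofReal_mul hc.le,
    mul_assoc]

/-- The quantum entropy is positively homogeneous. -/
theorem qEntropy_smul {c : ℝ} (hc : 0 < c) (A : E →L[ℂ] E) :
    qEntropy (c • A) = ENNReal.ofReal c * qEntropy A := by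
  have h0 : ENNReal.ofReal c ≠ 0 := by simpa using hc
  simp_rw [qEntropy, ENNReal.mul_iInf_of_ne h0 ENNReal.ofReal_ne_top, qf_smul, clEntropy_mul hc]

theorem clEntropy_add_ofReal_entFun {ι : Type*} {x : ι → ℝ} (hx : ∀ i, 0 ≤ x i) {T : ℝ}
    (hT : HasSum x T) (hT1 : T ≤ 1) :
    clEntropy x + ENNReal.ofReal (entFun T) = ∑' i, ENNReal.ofReal (entFun (x i)) := by
  rw [clEntropy, hT.tsum_eq]
  rcases (hT.nonneg hx).eq_or_lt with rfl | hpos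
  · have h0 := (hasSum_zero_iff_of_nonneg hx).1 hT
    simp [h0]
  · have hL : 0 ≤ 2 - Real.log T := by
      have := Real.log_nonpos hpos.le hT1
      linarith
    have h1 : ENNReal.ofReal (entFun T) = ∑' i, ENNReal.ofReal (x i * (2 - Real.log T)) := by
      rw [← ENNReal.ofReal_tsum_of_nonneg (fun i => mul_nonneg (hx i) hL)
        (hT.summable.mul_right _), tsum_mul_right, hT.tsum_eq]
      congr 1
      simp only [entFun, Real.negMulLog]
      ring
    have h2 : ∀ i, x i / T ∈ Set.Icc (0 : ℝ) 1 := fun i =>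
      ⟨div_nonneg (hx i) hpos.le, (div_le_one hpos).2 (le_hasSum hT i fun j _ => hx j)⟩
    rw [h1, ← ENNReal.tsum_mul_left, ← ENNReal.tsum_add]
    refine tsum_congr fun i => ?_
    rw [← ENNReal.ofReal_mul hpos.le, ← ENNReal.ofReal_add
      (mul_nonneg hpos.le (Real.negMulLog_nonneg (h2 i).1 (h2 i).2)) (mul_nonneg (hx i) hL)]
    congr 1
    rcases (hx i).eq_or_lt with h | h
    · simp [← h]
    · simp only [entFun, Real.negMulLog]
      rw [Real.log_div h.ne' hpos.ne']
      field_simp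
      ring

/-- The sum of `f` over the spectrum of `A`, as an infimum over orthonormal bases. -/
def specSum (f : ℝ → ℝ) (A : E →L[ℂ] E) : ℝ≥0∞ :=
  ⨅ (s : Set E) (_ : IsONB s), diagSum f s A

theorem specSum_le (f : ℝ → ℝ) (A : E →L[ℂ] E) {s : Set E} (hs : IsONB s) :
    specSum f A ≤ diagSum f s A := iInf₂_le s hs

theorem IsEigenbasis.specSum_eq {f : ℝ → ℝ} (hf : IsConcaveGauge f) {A : E →L[ℂ] E}
    (hA : A.IsPositive) (hA1 : traceENN A ≤ 1) {s : Set E} (hs : IsEigenbasis s A) :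
    specSum f A = diagSum f s A :=
  (specSum_le f A hs.1).antisymm (le_iInf₂ fun _ ht => hs.diagSum_le hf hA hA1 ht)

theorem exists_isEigenbasis {A : E →L[ℂ] E} (hA : A.IsPositive) (hA1 : traceENN A ≤ 1) :
    ∃ s, IsEigenbasis s A :=
  exists_eigenbasis_of_traceENN hA (ne_top_of_le_ne_top ENNReal.one_ne_top hA1)

theorem qEntropy_add_ofReal_entFun {A : E →L[ℂ] E} (hA : A.IsPositive) (hA1 : traceENN A ≤ 1) :
    qEntropy A + ENNReal.ofReal (entFun (traceENN A).toReal) = specSum entFun A := by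
  simp_rw [qEntropy, specSum, ENNReal.iInf_add]
  refine iInf_congr fun s => iInf_congr fun hs => ?_
  have h := tsum_qf_eq_traceENN hA hs
  have hfin : ∑' v : s, ENNReal.ofReal (qf A v) ≠ ∞ := by
    rw [h]; exact ne_top_of_le_ne_top ENNReal.one_ne_top hA1
  have hT : HasSum (fun v : s => qf A v) (traceENN A).toReal := by
    rw [← h, ENNReal.tsum_toReal_eq fun v => ENNReal.ofReal_ne_top]
    refine (hasSum_congr fun v : s => ENNReal.toReal_ofReal (qf_nonneg hA v)).1 ?_
    exact (ENNReal.summable_toReal hfin).hasSum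
  exact clEntropy_add_ofReal_entFun (fun v : s => qf_nonneg hA v) hT
    (ENNReal.toReal_le_of_le_ofReal zero_le_one (by simpa using hA1))

theorem specSum_entFun_eq {A : E →L[ℂ] E} (hA : A.IsPositive) (hA1 : traceENN A ≤ 1) {δ : ℝ}
    (hδ : δ ∈ Set.Ioc (0 : ℝ) 1) :
    specSum entFun A = specSum (tailFun δ) A + specSum (headFun δ) A := by
  obtain ⟨s, hs⟩ := exists_isEigenbasis hA hA1
  rw [hs.specSum_eq isConcaveGauge_entFun hA hA1,
    hs.specSum_eq (isConcaveGauge_tailFun hδ.1) hA hA1,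
    hs.specSum_eq (isConcaveGauge_headFun hδ) hA hA1, diagSum, diagSum, diagSum,
    ← ENNReal.tsum_add]
  refine tsum_congr fun v => ?_
  have hv := qf_mem_Icc hA hA1 hs.1 v
  rw [← ENNReal.ofReal_add (tailFun_nonneg hδ.1 hv.1) ((isConcaveGauge_headFun hδ).2.1 _ hv),
    tailFun_add_headFun]

/-- The Lipschitz part of the entropy is controlled by the differences of diagonals. -/
theorem specSum_headFun_le {A B : E →L[ℂ] E} (hA : A.IsPositive) (hA1 : traceENN A ≤ 1)
    (hB : B.IsPositive) (hB1 : traceENN B ≤ 1) {δ : ℝ} (hδ : δ ∈ Set.Ioc (0 : ℝ) 1) {C : ℝ≥0∞}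
    (hC : ∀ s : Set E, IsONB s → ∑' v : s, ENNReal.ofReal |qf A v - qf B v| ≤ C) :
    specSum (headFun δ) A ≤
      specSum (headFun δ) B + ENNReal.ofReal (1 - Real.log δ) * C := by
  have hL : 0 ≤ 1 - Real.log δ := by
    have := Real.log_nonpos hδ.1.le hδ.2
    linarith
  obtain ⟨s, hs⟩ := exists_isEigenbasis hB hB1
  rw [hs.specSum_eq (isConcaveGauge_headFun hδ) hB hB1]
  refine (specSum_le _ A hs.1).trans ?_
  calc diagSum (headFun δ) s A
      ≤ ∑' v : s, (ENNReal.ofReal (headFun δ (qf B v)) +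
          ENNReal.ofReal (1 - Real.log δ) * ENNReal.ofReal |qf A v - qf B v|) := by
        refine ENNReal.tsum_le_tsum fun v => ?_
        have hv := qf_mem_Icc hB hB1 hs.1 v
        rw [← ENNReal.ofReal_mul hL, ← ENNReal.ofReal_add
          ((isConcaveGauge_headFun hδ).2.1 _ hv) (mul_nonneg hL (abs_nonneg _))]
        exact ENNReal.ofReal_le_ofReal (headFun_le_add hδ (qf_mem_Icc hA hA1 hs.1 v) hv)
    _ = diagSum (headFun δ) s B +
          ENNReal.ofReal (1 - Real.log δ) * ∑' v : s, ENNReal.ofReal |qf A v - qf B v| := by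
        rw [ENNReal.tsum_add, ENNReal.tsum_mul_left, diagSum]
    _ ≤ _ := by gcongr; exact hC s hs.1

theorem specSum_headFun_ne_top {A : E →L[ℂ] E} (hA : A.IsPositive) (hA1 : traceENN A ≤ 1) {δ : ℝ}
    (hδ : δ ∈ Set.Ioc (0 : ℝ) 1) : specSum (headFun δ) A ≠ ∞ := by
  have h0 : traceENN (0 : E →L[ℂ] E) = 0 := by simp [traceENN, qf]
  have h := specSum_headFun_le hA hA1 ContinuousLinearMap.isPositive_zero (h0.le.trans zero_le_one)
    hδ (C := 1) fun s hs => by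
      refine le_trans (le_of_eq ?_) hA1
      rw [← tsum_qf_eq_traceENN hA hs]
      refine tsum_congr fun v => ?_
      rw [show qf (0 : E →L[ℂ] E) v = 0 by simp [qf], sub_zero, abs_of_nonneg (qf_nonneg hA v)]
  have h2 : specSum (headFun δ) (0 : E →L[ℂ] E) = 0 := by
    obtain ⟨s, hs⟩ := exists_isONB E
    refine le_antisymm ((specSum_le _ _ hs).trans ?_) zero_le
    simp [diagSum, qf]
  rw [h2, zero_add, mul_one] at h
  exact ne_top_of_le_ne_top ENNReal.ofReal_ne_top h

theorem traceENN_le_add {A B : E →L[ℂ] E} (hA : A.IsPositive) (hB : B.IsPositive) {C : ℝ≥0∞}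
    (hC : ∀ s : Set E, IsONB s → ∑' v : s, ENNReal.ofReal |qf A v - qf B v| ≤ C) :
    traceENN A ≤ traceENN B + C := by
  obtain ⟨s, hs⟩ := exists_isONB E
  refine le_trans ?_ (add_le_add_right (hC s hs) _)
  rw [← tsum_qf_eq_traceENN hA hs, ← tsum_qf_eq_traceENN hB hs, ← ENNReal.tsum_add]
  refine ENNReal.tsum_le_tsum fun v => ?_
  rw [← ENNReal.ofReal_add (qf_nonneg hB v) (abs_nonneg _)]
  exact ENNReal.ofReal_le_ofReal (by linarith [le_abs_self (qf A v - qf B v)])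

theorem exists_specSum_tailFun_lt {A : E →L[ℂ] E} (hA : A.IsPositive) (hA1 : traceENN A ≤ 1)
    (hfin : specSum entFun A ≠ ∞) {ε : ℝ} (hε : 0 < ε) :
    ∃ δ ∈ Set.Ioc (0 : ℝ) 1, specSum (tailFun δ) A < ENNReal.ofReal ε := by
  obtain ⟨s, hs⟩ := exists_isEigenbasis hA hA1
  have hv := qf_mem_Icc hA hA1 hs.1
  rw [hs.specSum_eq isConcaveGauge_entFun hA hA1, diagSum] at hfin
  have hsum : Summable fun v : s => entFun (qf A v) :=
    (ENNReal.summable_toReal hfin).congr fun v =>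
      ENNReal.toReal_ofReal (isConcaveGauge_entFun.2.1 _ (hv v))
  have hI : ∀ᶠ δ in 𝓝[>] (0 : ℝ), δ ∈ Set.Ioc (0 : ℝ) 1 := Ioc_mem_nhdsGT zero_lt_one
  have hlim := tendsto_tsum_of_dominated_convergence (𝓕 := 𝓝[>] (0 : ℝ))
    (f := fun δ (v : s) => tailFun δ (qf A v)) (g := fun _ => 0) hsum
    (fun v => tendsto_tailFun _) (by
      filter_upwards [hI] with δ hδ v
      rw [Real.norm_of_nonneg (tailFun_nonneg hδ.1 (hv v).1)]
      exact tailFun_le_entFun hδ (hv v))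
  rw [tsum_zero] at hlim
  obtain ⟨δ, hδ, hlt⟩ := (hI.and (hlim.eventually_lt_const hε)).exists
  refine ⟨δ, hδ, (specSum_le _ _ hs.1).trans_lt ?_⟩
  have h0 : ∀ v : s, 0 ≤ tailFun δ (qf A v) := fun v => tailFun_nonneg hδ.1 (hv v).1
  rw [diagSum, ← ENNReal.ofReal_tsum_of_nonneg h0
    (.of_nonneg_of_le h0 (fun v => tailFun_le_entFun hδ (hv v)) hsum)]
  exact (ENNReal.ofReal_lt_ofReal_iff hε).2 hlt

theorem specSum_tailFun_add_le {A B : E →L[ℂ] E} (hA : A.IsPositive) (hB : B.IsPositive)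
    (h1 : traceENN (A + B) ≤ 1) {δ : ℝ} (hδ : 0 < δ) :
    specSum (tailFun δ) (A + B) ≤ specSum (tailFun δ) A + specSum (tailFun δ) B := by
  have hf := isConcaveGauge_tailFun hδ
  have h2 := traceENN_add hA hB ▸ h1
  have hA1 := le_self_add.trans h2
  have hB1 := le_add_self.trans h2
  obtain ⟨r, hr⟩ := exists_isEigenbasis hA hA1
  obtain ⟨s, hs⟩ := exists_isEigenbasis hB hB1
  obtain ⟨t, ht⟩ := exists_isEigenbasis (hA.add hB) h1
  rw [hr.specSum_eq hf hA hA1, hs.specSum_eq hf hB hB1, ht.specSum_eq hf (hA.add hB) h1]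
  exact IsEigenbasis.diagSum_add_le hf hA hB h1 hr hs ht

theorem specSum_tailFun_le_add {A B : E →L[ℂ] E} (hA : A.IsPositive) (hB : B.IsPositive) {δ : ℝ}
    (hδ : 0 < δ) : specSum (tailFun δ) A ≤ specSum (tailFun δ) (A + B) := by
  refine iInf₂_mono fun s hs => ENNReal.tsum_le_tsum fun v => ?_
  rw [qf_add]
  exact ENNReal.ofReal_le_ofReal
    (tailFun_mono hδ (qf_nonneg hA v) (le_add_of_nonneg_right (qf_nonneg hB v)))

theorem specSum_tailFun_mono {A : E →L[ℂ] E} (hA : A.IsPositive) {δ δ' : ℝ} (hδ : 0 < δ)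
    (h : δ ≤ δ') : specSum (tailFun δ) A ≤ specSum (tailFun δ') A :=
  iInf₂_mono fun _ _ => ENNReal.tsum_le_tsum fun v =>
    ENNReal.ofReal_le_ofReal (tailFun_mono_left hδ h (qf_nonneg hA v))

end Entropy

section Continuity

variable {E F : Type*}
variable [NormedAddCommGroup E] [InnerProductSpace ℂ E] [CompleteSpace E]
variable [NormedAddCommGroup F] [InnerProductSpace ℂ F] [CompleteSpace F]

theorem ContOn.congr {f g : (E →L[ℂ] E) → ℝ≥0∞} {𝒜 : Set (E →L[ℂ] E)} (hf : ContOn f 𝒜)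
    (h : ∀ A ∈ 𝒜, g A = f A) : ContOn g 𝒜 := by
  refine ⟨fun A hA => h A hA ▸ hf.1 A hA, fun A hA ε hε => ?_⟩
  obtain ⟨r, hr, hB⟩ := hf.2 A hA ε hε
  exact ⟨r, hr, fun B hB' hd => by rw [h A hA, h B hB']; exact hB B hB' hd⟩

theorem contOn_add_iff {f g k : (E →L[ℂ] E) → ℝ≥0∞} {𝒜 : Set (E →L[ℂ] E)} (hk : ContOn k 𝒜)
    (h : ∀ A ∈ 𝒜, g A = f A + k A) : ContOn g 𝒜 ↔ ContOn f 𝒜 := by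
  have hfin : (∀ A ∈ 𝒜, g A ≠ ∞) ↔ ∀ A ∈ 𝒜, f A ≠ ∞ :=
    forall₂_congr fun A hA => by simp [h A hA, hk.1 A hA]
  have hreal : (∀ A ∈ 𝒜, f A ≠ ∞) → ∀ A ∈ 𝒜, (g A).toReal = (f A).toReal + (k A).toReal :=
    fun hf A hA => by rw [h A hA, ENNReal.toReal_add (hf A hA) (hk.1 A hA)]
  constructor
  · refine fun hg => ⟨hfin.1 hg.1, fun A hA ε hε => ?_⟩
    obtain ⟨r, hr, hB⟩ := hg.2 A hA (ε / 2) (by positivity)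
    obtain ⟨r', hr', hB'⟩ := hk.2 A hA (ε / 2) (by positivity)
    refine ⟨min r r', lt_min hr hr', fun B hBA hd => ?_⟩
    have h1 := hB B hBA (hd.trans_le (ENNReal.ofReal_le_ofReal (min_le_left _ _)))
    have h2 := hB' B hBA (hd.trans_le (ENNReal.ofReal_le_ofReal (min_le_right _ _)))
    rw [hreal (hfin.1 hg.1) A hA, hreal (hfin.1 hg.1) B hBA] at h1
    rw [abs_lt] at h1 h2 ⊢
    constructor <;> linarith
  · refine fun hf => ⟨hfin.2 hf.1, fun A hA ε hε => ?_⟩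
    obtain ⟨r, hr, hB⟩ := hf.2 A hA (ε / 2) (by positivity)
    obtain ⟨r', hr', hB'⟩ := hk.2 A hA (ε / 2) (by positivity)
    refine ⟨min r r', lt_min hr hr', fun B hBA hd => ?_⟩
    have h1 := hB B hBA (hd.trans_le (ENNReal.ofReal_le_ofReal (min_le_left _ _)))
    have h2 := hB' B hBA (hd.trans_le (ENNReal.ofReal_le_ofReal (min_le_right _ _)))
    rw [hreal hf.1 A hA, hreal hf.1 B hBA]
    rw [abs_lt] at h1 h2 ⊢
    constructor <;> linarith

theorem ContOn.const_mul {f : (E →L[ℂ] E) → ℝ≥0∞} {𝒜 : Set (E →L[ℂ] E)} (hf : ContOn f 𝒜)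
    {c : ℝ} (hc : 0 < c) : ContOn (fun A => ENNReal.ofReal c * f A) 𝒜 := by
  refine ⟨fun A hA => ENNReal.mul_ne_top ENNReal.ofReal_ne_top (hf.1 A hA), fun A hA ε hε => ?_⟩
  obtain ⟨r, hr, hB⟩ := hf.2 A hA (ε / c) (by positivity)
  refine ⟨r, hr, fun B hBA hd => ?_⟩
  simp only [ENNReal.toReal_mul, ENNReal.toReal_ofReal hc.le]
  rw [← mul_sub, abs_mul, abs_of_pos hc, mul_comm]
  exact (lt_div_iff₀ hc).1 (hB B hBA hd)

theorem contOn_qEntropy_smul_iff {γ : (E →L[ℂ] E) → (F →L[ℂ] F)} {𝒜 : Set (E →L[ℂ] E)} {c : ℝ}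
    (hc : 0 < c) :
    ContOn (fun A => qEntropy (c • γ A)) 𝒜 ↔ ContOn (fun A => qEntropy (γ A)) 𝒜 := by
  simp_rw [qEntropy_smul hc]
  refine ⟨fun h => (h.const_mul (inv_pos.2 hc)).congr fun A _ => ?_, fun h => h.const_mul hc⟩
  rw [← mul_assoc, ← ENNReal.ofReal_mul (inv_pos.2 hc).le, inv_mul_cancel₀ hc.ne',
    ENNReal.ofReal_one, one_mul]

theorem traceNorm_sub_comm (A B : E →L[ℂ] E) : traceNorm (A - B) = traceNorm (B - A) := by
  simp_rw [traceNorm, sub_apply, inner_sub_right, norm_sub_rev]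

/-- A function satisfying a one-sided Lipschitz bound in the trace norm is continuous. -/
theorem contOn_of_le_add {f : (E →L[ℂ] E) → ℝ≥0∞} {𝒜 : Set (E →L[ℂ] E)} {L : ℝ} (hL : 0 ≤ L)
    (hfin : ∀ A ∈ 𝒜, f A ≠ ∞)
    (h : ∀ A ∈ 𝒜, ∀ B ∈ 𝒜, f A ≤ f B + ENNReal.ofReal L * traceNorm (A - B)) : ContOn f 𝒜 := by
  refine ⟨hfin, fun A hA ε hε => ⟨ε / (2 * (L + 1)), by positivity, fun B hB hd => ?_⟩⟩
  have hbound : ENNReal.ofReal L * traceNorm (B - A) ≤ ENNReal.ofReal (ε / 2) := by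
    calc ENNReal.ofReal L * traceNorm (B - A)
        ≤ ENNReal.ofReal L * ENNReal.ofReal (ε / (2 * (L + 1))) := by gcongr
      _ = ENNReal.ofReal (L * (ε / (2 * (L + 1)))) := (ENNReal.ofReal_mul hL).symm
      _ ≤ _ := by
        refine ENNReal.ofReal_le_ofReal ?_
        rw [mul_div_assoc', div_le_div_iff₀ (by positivity) (by positivity)]
        nlinarith
  have key : ∀ X ∈ 𝒜, ∀ Y ∈ 𝒜, ENNReal.ofReal L * traceNorm (X - Y) ≤ ENNReal.ofReal (ε / 2) →
      (f X).toReal ≤ (f Y).toReal + ε / 2 := fun X hX Y hY hXY => by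
    have h1 := (h X hX Y hY).trans (add_le_add_right hXY _)
    have h2 := ENNReal.toReal_mono (ENNReal.add_ne_top.2 ⟨hfin Y hY, ENNReal.ofReal_ne_top⟩) h1
    rwa [ENNReal.toReal_add (hfin Y hY) ENNReal.ofReal_ne_top,
      ENNReal.toReal_ofReal (by positivity)] at h2
  have h1 := key B hB A hA hbound
  have h2 := key A hA B hB (by rwa [traceNorm_sub_comm])
  rw [abs_lt]
  constructor <;> linarith

/-- A positive additive trace-non-increasing map on the positive trace-class cone. -/
structure IsPosTNI (γ : (E →L[ℂ] E) → (F →L[ℂ] F)) : Prop where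
  map_add : ∀ A B, A.IsPositive → B.IsPositive → traceENN A ≠ ∞ → traceENN B ≠ ∞ →
    γ (A + B) = γ A + γ B
  pos : ∀ A, A.IsPositive → traceENN A ≠ ∞ → (γ A).IsPositive
  tni : ∀ A, A.IsPositive → traceENN A ≠ ∞ → traceENN (γ A) ≤ traceENN A

theorem TraceMap.TNI.isPosTNI {Φ : TraceMap E F} (hΦ : Φ.TNI) : IsPosTNI Φ.toFun where
  map_add A B hA hB hA' hB' :=
    Φ.map_add A B (isTC_of_isPositive hA hA') (isTC_of_isPositive hB hB')
  pos A hA hA' := Φ.pos A (isTC_of_isPositive hA hA') hA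
  tni A hA hA' := hΦ A (isTC_of_isPositive hA hA') hA

theorem IsPosTNI.smul {γ : (E →L[ℂ] E) → (F →L[ℂ] F)} (hγ : IsPosTNI γ) {c : ℝ}
    (hc : c ∈ Set.Icc (0 : ℝ) 1) : IsPosTNI fun A => c • γ A where
  map_add A B hA hB hA' hB' := by rw [hγ.map_add A B hA hB hA' hB', smul_add]
  pos A hA hA' := isPositive_real_smul (hγ.pos A hA hA') hc.1
  tni A hA hA' := by
    rw [traceENN_smul (hγ.pos A hA hA') hc.1]
    exact (mul_le_of_le_one_left' (by simpa using hc.2)).trans (hγ.tni A hA hA')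

theorem IsPosTNI.convexComb {γ γ' : (E →L[ℂ] E) → (F →L[ℂ] F)} (hγ : IsPosTNI γ)
    (hγ' : IsPosTNI γ') {c : ℝ} (hc : c ∈ Set.Icc (0 : ℝ) 1) :
    IsPosTNI fun A => c • γ A + (1 - c) • γ' A where
  map_add A B hA hB hA' hB' := by
    rw [hγ.map_add A B hA hB hA' hB', hγ'.map_add A B hA hB hA' hB', smul_add, smul_add]
    abel
  pos A hA hA' := (isPositive_real_smul (hγ.pos A hA hA') hc.1).add
    (isPositive_real_smul (hγ'.pos A hA hA') (sub_nonneg.2 hc.2))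
  tni A hA hA' := by
    have h1 := hγ.pos A hA hA'
    have h2 := hγ'.pos A hA hA'
    have hc' := sub_nonneg.2 hc.2
    rw [traceENN_add (isPositive_real_smul h1 hc.1) (isPositive_real_smul h2 hc'),
      traceENN_smul h1 hc.1, traceENN_smul h2 hc']
    calc ENNReal.ofReal c * traceENN (γ A) + ENNReal.ofReal (1 - c) * traceENN (γ' A)
        ≤ ENNReal.ofReal c * traceENN A + ENNReal.ofReal (1 - c) * traceENN A := by
          gcongr
          exacts [hγ.tni A hA hA', hγ'.tni A hA hA']
      _ = traceENN A := by rw [← add_mul, ← ENNReal.ofReal_add hc.1 hc']; simp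

namespace IsPosTNI

variable {γ : (E →L[ℂ] E) → (F →L[ℂ] F)}

theorem pos_of_mem {ρ : E →L[ℂ] E} (hγ : IsPosTNI γ) (hρ : ρ ∈ states E) : (γ ρ).IsPositive :=
  hγ.pos ρ hρ.1 (by rw [hρ.2]; exact ENNReal.one_ne_top)

theorem traceENN_le_one {ρ : E →L[ℂ] E} (hγ : IsPosTNI γ) (hρ : ρ ∈ states E) :
    traceENN (γ ρ) ≤ 1 :=
  (hγ.tni ρ hρ.1 (by rw [hρ.2]; exact ENNReal.one_ne_top)).trans hρ.2.le

theorem tsum_abs_sub_le (hγ : IsPosTNI γ) {ρ σ : E →L[ℂ] E} (hρ : ρ ∈ states E)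
    (hσ : σ ∈ states E) (s : Set F) (hs : IsONB s) :
    ∑' v : s, ENNReal.ofReal |qf (γ ρ) v - qf (γ σ) v| ≤ 2 * traceNorm (ρ - σ) := by
  have hρ' : traceENN ρ ≠ ∞ := by rw [hρ.2]; exact ENNReal.one_ne_top
  have hσ' : traceENN σ ≠ ∞ := by rw [hσ.2]; exact ENNReal.one_ne_top
  by_cases htop : traceNorm (ρ - σ) = ∞
  · simp [htop]
  obtain ⟨P, N, hP, hN, heq, hP1, hN1⟩ := exists_jordan hρ.1 hσ.1 hρ' hσ'
  have hP' := ne_top_of_le_ne_top htop hP1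
  have hN' := ne_top_of_le_ne_top htop hN1
  have hγeq : γ ρ + γ N = γ σ + γ P := by
    rw [← hγ.map_add _ _ hρ.1 hN hρ' hN', heq, hγ.map_add _ _ hσ.1 hP hσ' hP']
  have hγP := hγ.pos P hP hP'
  have hγN := hγ.pos N hN hN'
  calc ∑' v : s, ENNReal.ofReal |qf (γ ρ) v - qf (γ σ) v|
      ≤ ∑' v : s, (ENNReal.ofReal (qf (γ P) v) + ENNReal.ofReal (qf (γ N) v)) := by
        refine ENNReal.tsum_le_tsum fun v => ?_
        have h1 := congrArg (fun A => qf A (v : F)) hγeq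
        simp only [qf_add] at h1
        have h2 := qf_nonneg hγP v
        have h3 := qf_nonneg hγN v
        rw [← ENNReal.ofReal_add h2 h3]
        refine ENNReal.ofReal_le_ofReal (abs_le.2 ⟨?_, ?_⟩) <;> linarith
    _ = traceENN (γ P) + traceENN (γ N) := by
        rw [ENNReal.tsum_add, tsum_qf_eq_traceENN hγP hs, tsum_qf_eq_traceENN hγN hs]
    _ ≤ _ := by
        rw [two_mul]
        exact add_le_add ((hγ.tni P hP hP').trans hP1) ((hγ.tni N hN hN').trans hN1)

theorem contOn_traceENN (hγ : IsPosTNI γ) : ContOn (fun ρ => traceENN (γ ρ)) (states E) := by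
  refine contOn_of_le_add zero_le_two
    (fun ρ hρ => ne_top_of_le_ne_top ENNReal.one_ne_top (hγ.traceENN_le_one hρ))
    fun ρ hρ σ hσ => ?_
  simpa using traceENN_le_add (hγ.pos_of_mem hρ) (hγ.pos_of_mem hσ) (hγ.tsum_abs_sub_le hρ hσ)

theorem contOn_ofReal_entFun (hγ : IsPosTNI γ) :
    ContOn (fun ρ => ENNReal.ofReal (entFun (traceENN (γ ρ)).toReal)) (states E) := by
  refine ⟨fun _ _ => ENNReal.ofReal_ne_top, fun ρ hρ ε hε => ?_⟩
  have hnn : ∀ σ ∈ states E, 0 ≤ entFun (traceENN (γ σ)).toReal := fun σ hσ =>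
    isConcaveGauge_entFun.2.1 _ ⟨ENNReal.toReal_nonneg,
      ENNReal.toReal_le_of_le_ofReal zero_le_one (by simpa using hγ.traceENN_le_one hσ)⟩
  obtain ⟨η, hη, hcont⟩ := Metric.continuous_iff.1 continuous_entFun (traceENN (γ ρ)).toReal ε hε
  obtain ⟨r, hr, hσ⟩ := hγ.contOn_traceENN.2 ρ hρ η hη
  refine ⟨r, hr, fun σ hσ' hd => ?_⟩
  rw [ENNReal.toReal_ofReal (hnn σ hσ'), ENNReal.toReal_ofReal (hnn ρ hρ)]
  exact hcont _ (hσ σ hσ' hd)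

theorem contOn_specSum_headFun (hγ : IsPosTNI γ) {δ : ℝ} (hδ : δ ∈ Set.Ioc (0 : ℝ) 1) :
    ContOn (fun ρ => specSum (headFun δ) (γ ρ)) (states E) := by
  have hL : 0 ≤ 1 - Real.log δ := by
    have := Real.log_nonpos hδ.1.le hδ.2
    linarith
  refine contOn_of_le_add (mul_nonneg hL zero_le_two)
    (fun ρ hρ => specSum_headFun_ne_top (hγ.pos_of_mem hρ) (hγ.traceENN_le_one hρ) hδ)
    fun ρ hρ σ hσ => ?_
  have h := specSum_headFun_le (hγ.pos_of_mem hρ) (hγ.traceENN_le_one hρ) (hγ.pos_of_mem hσ)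
    (hγ.traceENN_le_one hσ) hδ (hγ.tsum_abs_sub_le hρ hσ)
  rw [ENNReal.ofReal_mul hL, mul_assoc]
  simpa using h

theorem contOn_qEntropy_iff_entFun (hγ : IsPosTNI γ) :
    ContOn (fun ρ => qEntropy (γ ρ)) (states E) ↔
      ContOn (fun ρ => specSum entFun (γ ρ)) (states E) :=
  (contOn_add_iff hγ.contOn_ofReal_entFun fun _ hρ =>
    (qEntropy_add_ofReal_entFun (hγ.pos_of_mem hρ) (hγ.traceENN_le_one hρ)).symm).symm

theorem contOn_qEntropy_iff_tailFun (hγ : IsPosTNI γ) {δ : ℝ} (hδ : δ ∈ Set.Ioc (0 : ℝ) 1) :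
    ContOn (fun ρ => qEntropy (γ ρ)) (states E) ↔
      ContOn (fun ρ => specSum (tailFun δ) (γ ρ)) (states E) := by
  rw [hγ.contOn_qEntropy_iff_entFun]
  exact contOn_add_iff (hγ.contOn_specSum_headFun hδ) fun ρ hρ =>
    specSum_entFun_eq (hγ.pos_of_mem hρ) (hγ.traceENN_le_one hρ) hδ

end IsPosTNI

/-- Locally on the state space, the tails of the output entropy are uniformly small. -/
def HasSmallTails (γ : (E →L[ℂ] E) → (F →L[ℂ] F)) : Prop :=
  ∀ ρ ∈ states E, ∀ ε : ℝ, 0 < ε → ∃ δ ∈ Set.Ioc (0 : ℝ) 1, ∃ r : ℝ, 0 < r ∧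
    ∀ σ ∈ states E, traceNorm (σ - ρ) < ENNReal.ofReal r →
      specSum (tailFun δ) (γ σ) ≤ ENNReal.ofReal ε

theorem IsPosTNI.contOn_qEntropy_iff {γ : (E →L[ℂ] E) → (F →L[ℂ] F)} (hγ : IsPosTNI γ) :
    ContOn (fun ρ => qEntropy (γ ρ)) (states E) ↔ HasSmallTails γ := by
  have hS := hγ.contOn_qEntropy_iff_entFun
  constructor
  · intro h ρ hρ ε hε
    obtain ⟨δ, hδ, hlt⟩ := exists_specSum_tailFun_lt (hγ.pos_of_mem hρ) (hγ.traceENN_le_one hρ)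
      ((hS.1 h).1 ρ hρ) (half_pos hε)
    have hF := (hγ.contOn_qEntropy_iff_tailFun hδ).1 h
    obtain ⟨r, hr, hσ⟩ := hF.2 ρ hρ (ε / 2) (half_pos hε)
    refine ⟨δ, hδ, r, hr, fun σ hσ' hd => ?_⟩
    have h1 := hσ σ hσ' hd
    have h2 := (ENNReal.lt_ofReal_iff_toReal_lt (hF.1 ρ hρ)).1 hlt
    rw [ENNReal.le_ofReal_iff_toReal_le (hF.1 σ hσ') hε.le]
    rw [abs_lt] at h1
    linarith
  · intro h
    have hself : ∀ ρ : E →L[ℂ] E, ∀ r : ℝ, 0 < r → traceNorm (ρ - ρ) < ENNReal.ofReal r :=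
      fun ρ r hr => by simpa [traceNorm] using hr
    have hdec := fun (ρ : E →L[ℂ] E) (hρ : ρ ∈ states E) (δ : ℝ) (hδ : δ ∈ Set.Ioc (0 : ℝ) 1) =>
      specSum_entFun_eq (hγ.pos_of_mem hρ) (hγ.traceENN_le_one hρ) hδ
    refine hS.2 ⟨fun ρ hρ => ?_, fun ρ hρ ε hε => ?_⟩
    · obtain ⟨δ, hδ, r, hr, hσ⟩ := h ρ hρ 1 one_pos
      beta_reduce
      rw [hdec ρ hρ δ hδ]
      exact ENNReal.add_ne_top.2 ⟨ne_top_of_le_ne_top ENNReal.ofReal_ne_top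
        (hσ ρ hρ (hself ρ r hr)), (hγ.contOn_specSum_headFun hδ).1 ρ hρ⟩
    · obtain ⟨δ, hδ, r, hr, hσ⟩ := h ρ hρ (ε / 2) (half_pos hε)
      have hG := hγ.contOn_specSum_headFun hδ
      obtain ⟨r', hr', hσ'⟩ := hG.2 ρ hρ (ε / 2) (half_pos hε)
      refine ⟨min r r', lt_min hr hr', fun σ hmem hd => ?_⟩
      have h1 := hσ' σ hmem (hd.trans_le (ENNReal.ofReal_le_ofReal (min_le_right _ _)))
      have h2 := hσ σ hmem (hd.trans_le (ENNReal.ofReal_le_ofReal (min_le_left _ _)))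
      have h3 := hσ ρ hρ (hself ρ r hr)
      have hfin2 := ne_top_of_le_ne_top ENNReal.ofReal_ne_top h2
      have hfin3 := ne_top_of_le_ne_top ENNReal.ofReal_ne_top h3
      rw [ENNReal.le_ofReal_iff_toReal_le hfin2 (half_pos hε).le] at h2
      rw [ENNReal.le_ofReal_iff_toReal_le hfin3 (half_pos hε).le] at h3
      have h4 := ENNReal.toReal_nonneg (a := specSum (tailFun δ) (γ σ))
      have h5 := ENNReal.toReal_nonneg (a := specSum (tailFun δ) (γ ρ))
      beta_reduce at h1 ⊢
      rw [hdec ρ hρ δ hδ, hdec σ hmem δ hδ, ENNReal.toReal_add hfin2 (hG.1 σ hmem),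
        ENNReal.toReal_add hfin3 (hG.1 ρ hρ)]
      rw [abs_lt] at h1 ⊢
      constructor <;> linarith

theorem hasSmallTails_add_iff {α β : (E →L[ℂ] E) → (F →L[ℂ] F)} (hα : IsPosTNI α)
    (hβ : IsPosTNI β) (hαβ : IsPosTNI fun A => α A + β A) :
    HasSmallTails (fun A => α A + β A) ↔ HasSmallTails α ∧ HasSmallTails β := by
  refine ⟨fun h => ⟨fun ρ hρ ε hε => ?_, fun ρ hρ ε hε => ?_⟩, fun h ρ hρ ε hε => ?_⟩
  · obtain ⟨δ, hδ, r, hr, hσ⟩ := h ρ hρ ε hε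
    exact ⟨δ, hδ, r, hr, fun σ hmem hd => (specSum_tailFun_le_add (hα.pos_of_mem hmem)
      (hβ.pos_of_mem hmem) hδ.1).trans (hσ σ hmem hd)⟩
  · obtain ⟨δ, hδ, r, hr, hσ⟩ := h ρ hρ ε hε
    refine ⟨δ, hδ, r, hr, fun σ hmem hd => ?_⟩
    have h1 := specSum_tailFun_le_add (hβ.pos_of_mem hmem) (hα.pos_of_mem hmem) hδ.1
    rw [add_comm] at h1
    exact h1.trans (hσ σ hmem hd)
  · obtain ⟨δ, hδ, r, hr, hσ⟩ := h.1 ρ hρ (ε / 2) (half_pos hε)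
    obtain ⟨δ', hδ', r', hr', hσ'⟩ := h.2 ρ hρ (ε / 2) (half_pos hε)
    have hmin : 0 < min δ δ' := lt_min hδ.1 hδ'.1
    refine ⟨min δ δ', ⟨hmin, (min_le_left _ _).trans hδ.2⟩, min r r', lt_min hr hr',
      fun σ hmem hd => ?_⟩
    have hpos := hα.pos_of_mem hmem
    have hpos' := hβ.pos_of_mem hmem
    have h1 := hσ σ hmem (hd.trans_le (ENNReal.ofReal_le_ofReal (min_le_left _ _)))
    have h2 := hσ' σ hmem (hd.trans_le (ENNReal.ofReal_le_ofReal (min_le_right _ _)))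
    refine (specSum_tailFun_add_le hpos hpos' (hαβ.traceENN_le_one hmem) hmin).trans ?_
    rw [← add_halves ε, ENNReal.ofReal_add (half_pos hε).le (half_pos hε).le]
    exact add_le_add ((specSum_tailFun_mono hpos hmin (min_le_left _ _)).trans h1)
      ((specSum_tailFun_mono hpos' hmin (min_le_right _ _)).trans h2)

end Continuity

/-- Corollary 1 of the paper. For positive linear trace-non-increasing
maps `Φ, Ψ` and `λ ∈ (0,1)`, the map `λΦ + (1−λ)Ψ` has continuous (and bounded, i.e.
finite) output entropy on `𝔖(H)` if and only if both `Φ` and `Ψ` do. -/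
theorem statement2
    {E F : Type*}
    [NormedAddCommGroup E] [InnerProductSpace ℂ E] [CompleteSpace E]
    [TopologicalSpace.SeparableSpace E]
    [NormedAddCommGroup F] [InnerProductSpace ℂ F] [CompleteSpace F]
    [TopologicalSpace.SeparableSpace F]
    (Φ Ψ : TraceMap E F) (hΦ : Φ.TNI) (hΨ : Ψ.TNI)
    (l : ℝ) (hl : l ∈ Set.Ioo (0 : ℝ) 1) :
    ContOn (fun ρ => qEntropy (l • Φ.toFun ρ + (1 - l) • Ψ.toFun ρ)) (states E) ↔
      ContOn (outEntropy Φ) (states E) ∧ ContOn (outEntropy Ψ) (states E) := by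
  have hl' : l ∈ Set.Icc (0 : ℝ) 1 := ⟨hl.1.le, hl.2.le⟩
  have hm' : 1 - l ∈ Set.Icc (0 : ℝ) 1 := ⟨sub_nonneg.2 hl'.2, sub_le_self _ hl'.1⟩
  have h1 := hΦ.isPosTNI.smul hl'
  have h2 := hΨ.isPosTNI.smul hm'
  have h3 := hΦ.isPosTNI.convexComb hΨ.isPosTNI hl'
  rw [h3.contOn_qEntropy_iff, hasSmallTails_add_iff h1 h2 h3, ← h1.contOn_qEntropy_iff,
    ← h2.contOn_qEntropy_iff, contOn_qEntropy_smul_iff hl.1,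
    contOn_qEntropy_smul_iff (sub_pos.2 hl.2)]
  rfl

end QIT
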